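/- arXiv:1106.2913 — 4 statements merged into one kernel-verified Lean document; each statement's English description precedes it below -/
import Mathlib

section
/- Let p > 1 be an integer, a = (a_1,…,a_p) ∈ ℤ^p, A = ∑_{i=1}^p a_i, and λ, τ > 0 real numbers with λ + a_i τ > 0 for all i. Let Δ₀(λ,τ) = {x ∈ ℝ^{p+1} : 0 ≤ x_i for i = 1,…,p, ∑_{i=1}^p x_i ≤ τ, and 0 ≤ x_{p+1} ≤ λ + ∑_{i=1}^p a_i x_i}. Then the coordinates x̄ of Cm(Δ₀(λ,τ)) are: x̄_k = (τ/(p+2)) · (λ(p+2) + τ(A + a_k)) / (λ(p+1) + τA) for k = 1,…,p, and x̄_{p+1} = (1/2) · ((p+1)(p+2)λ² + 2(p+2)Aλτ + (a·a + A²)τ²) / ((p+2)((p+1)λ + Aτ)), where a·a = ∑_{i=1}^p a_i². -/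
open MeasureTheory

noncomputable section

/-- Center of mass of a subset of ℝⁿ: `Cm(K) = (∫_K x dx)/(∫_K 1 dx)`. -/
def Cm {n : ℕ} (K : Set (Fin n → ℝ)) : Fin n → ℝ :=
  (∫ x in K, (1 : ℝ))⁻¹ • ∫ x in K, x

/-- The Δ_p bundle over Δ_1 realized as a polytope in ℝ^{p+1}:
`Δ₀(λ,τ) = {x : 0 ≤ x_i (i ≤ p), ∑_{i≤p} x_i ≤ τ, 0 ≤ x_{p+1} ≤ λ + ∑ a_i x_i}`. -/
def Delta0 (p : ℕ) (a : Fin p → ℤ) (L T : ℝ) : Set (Fin (p + 1) → ℝ) :=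
  {x | (∀ i : Fin p, 0 ≤ x i.castSucc) ∧ (∑ i : Fin p, x i.castSucc) ≤ T ∧
      0 ≤ x (Fin.last p) ∧
      x (Fin.last p) ≤ L + ∑ i : Fin p, (a i : ℝ) * x i.castSucc}

open Finset in
lemma aux_beta (T : ℝ) (a : ℕ) : ∀ N : ℕ, ∫ t in (0:ℝ)..T, t ^ a * (T - t) ^ N =
    T ^ (a + N + 1) * (a.factorial * N.factorial) / (a + N + 1).factorial := by
  induction a with
  | zero =>
    intro N
    have h := intervalIntegral.integral_comp_sub_left (fun x : ℝ => x ^ N) T (a := 0) (b := T)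
    simp only [pow_zero, one_mul]
    rw [h]
    simp only [sub_self, sub_zero, integral_pow]
    have : (N.factorial : ℝ) ≠ 0 := by positivity
    rw [zero_add, Nat.factorial_succ]
    push_cast
    field_simp
    simp
  | succ a ih =>
    intro N
    have hu : ∀ x ∈ Set.uIcc (0:ℝ) T, HasDerivAt (fun t : ℝ => t ^ (a+1)) (((a:ℝ)+1) * x ^ a) x := by
      intro x _
      have := hasDerivAt_pow (a+1) x
      simpa using this
    have hv : ∀ x ∈ Set.uIcc (0:ℝ) T,
        HasDerivAt (fun t : ℝ => -(T - t) ^ (N+1) / ((N:ℝ)+1)) ((T - x) ^ N) x := by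
      intro x _
      have h1 : HasDerivAt (fun t : ℝ => T - t) (-1) x := by
        simpa using (hasDerivAt_id x).const_sub T
      have h2 := ((h1.pow (N+1)).neg).div_const ((N:ℝ)+1)
      refine h2.congr_deriv ?_
      push_cast
      have : (N:ℝ) + 1 ≠ 0 := by positivity
      field_simp
      try simp
    have := intervalIntegral.integral_mul_deriv_eq_deriv_mul hu hv
      (Continuous.intervalIntegrable (by fun_prop) _ _) (Continuous.intervalIntegrable (by fun_prop) _ _)
    rw [this]
    have h3 : ∀ x : ℝ, ((a:ℝ)+1) * x ^ a * (-(T - x) ^ (N+1) / ((N:ℝ)+1)) =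
        (-(((a:ℝ)+1) / ((N:ℝ)+1))) * (x ^ a * (T - x) ^ (N+1)) := by
      intro x; ring
    simp only [h3]
    rw [intervalIntegral.integral_const_mul, ih (N+1)]
    have e : a + 1 + N + 1 = a + (N+1) + 1 := by ring
    rw [e, Nat.factorial_succ a, Nat.factorial_succ N]
    have : (N:ℝ) + 1 ≠ 0 := by positivity
    push_cast
    simp
    field_simp

/-- The simplex. -/
def SxAux (n : ℕ) (T : ℝ) : Set (Fin n → ℝ) := {x | (∀ i, 0 ≤ x i) ∧ ∑ i, x i ≤ T}

lemma SxAux_compact (n : ℕ) (T : ℝ) : IsCompact (SxAux n T) := by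
  refine IsCompact.of_isClosed_subset (isCompact_Icc (a := (0 : Fin n → ℝ)) (b := fun _ => T)) ?_ ?_
  · have : SxAux n T = (⋂ i, {x : Fin n → ℝ | 0 ≤ x i}) ∩ {x | ∑ i, x i ≤ T} := by
      ext x; simp [SxAux]
    rw [this]
    exact (isClosed_iInter fun i => isClosed_le (by fun_prop) (by fun_prop)).inter
      (isClosed_le (by fun_prop) (by fun_prop))
  · intro x hx
    refine ⟨fun i => hx.1 i, fun i => ?_⟩
    exact (Finset.single_le_sum (f := x) (fun j _ => hx.1 j) (Finset.mem_univ i)).trans hx.2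

lemma aux_fub {n : ℕ} (K : Set (Fin (n+1) → ℝ)) (hK : IsCompact K) (f : (Fin (n+1) → ℝ) → ℝ)
    (hf : Continuous f) :
    ∫ x in K, f x = ∫ z : ℝ × (Fin n → ℝ), K.indicator f (Fin.snoc z.2 z.1) ∧
    Integrable (fun z : ℝ × (Fin n → ℝ) => K.indicator f (Fin.snoc z.2 z.1))
      ((volume : Measure ℝ).prod (volume : Measure (Fin n → ℝ))) := by
  have mp := (volume_preserving_piFinSuccAbove (fun _ : Fin (n+1) => ℝ) (Fin.last n)).symm
  have hI : Integrable (K.indicator f) volume :=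
    (integrable_indicator_iff hK.measurableSet).2 (hf.continuousOn.integrableOn_compact hK)
  have e : ∀ z : ℝ × (Fin n → ℝ), (MeasurableEquiv.piFinSuccAbove (fun _ : Fin (n+1) => ℝ)
      (Fin.last n)).symm z = (Fin.snoc z.2 z.1 : Fin (n+1) → ℝ) := by
    intro z
    simp [MeasurableEquiv.piFinSuccAbove, Fin.insertNthEquiv]
  constructor
  · rw [← integral_indicator hK.measurableSet, ← mp.integral_comp' ]
    simp only [e]
  · have := (mp.integrable_comp_emb (MeasurableEquiv.measurableEmbedding _)).2 hI
    rw [← Measure.volume_eq_prod]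
    simpa only [Function.comp_def, e] using this

lemma aux_mono : ∀ (n : ℕ) (m : Fin n → ℕ) (T : ℝ), 0 ≤ T →
    ∫ x in SxAux n T, ∏ i, x i ^ m i =
      T ^ (n + ∑ i, m i) * (∏ i, ((m i).factorial : ℝ)) / (n + ∑ i, m i).factorial := by
  intro n
  induction n with
  | zero =>
    intro m T hT
    have : SxAux 0 T = Set.univ := by ext x; simp [SxAux, hT]
    simp [this, Measure.real, volume_pi]
  | succ n ih =>
    intro m T hT
    obtain ⟨h1, h2⟩ := aux_fub (SxAux (n+1) T) (SxAux_compact _ _) (fun x => ∏ i, x i ^ m i)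
      (by fun_prop)
    rw [h1, Measure.volume_eq_prod, integral_prod _ h2]
    set N := n + ∑ i : Fin n, m i.castSucc with hN
    set c : ℝ := (∏ i : Fin n, ((m i.castSucc).factorial : ℝ)) / N.factorial with hc
    have key : ∀ t : ℝ, ∫ y : Fin n → ℝ, (SxAux (n+1) T).indicator (fun x => ∏ i, x i ^ m i)
        (Fin.snoc y t) = (Set.Icc 0 T).indicator
          (fun t => c * (t ^ (m (Fin.last n)) * (T - t) ^ N)) t := by
      intro t
      by_cases ht : t ∈ Set.Icc 0 T
      · rw [Set.indicator_of_mem ht]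
        have : ∀ y : Fin n → ℝ, (SxAux (n+1) T).indicator (fun x => ∏ i, x i ^ m i)
            (Fin.snoc y t) = (SxAux n (T - t)).indicator
            (fun y => t ^ (m (Fin.last n)) * ∏ i, y i ^ m i.castSucc) y := by
          intro y
          have hiff : (Fin.snoc y t : Fin (n+1) → ℝ) ∈ SxAux (n+1) T ↔ y ∈ SxAux n (T - t) := by
            simp only [SxAux, Set.mem_setOf_eq, Fin.forall_fin_succ', Fin.sum_univ_castSucc,
              Fin.snoc_castSucc, Fin.snoc_last, le_sub_iff_add_le]
            have := ht.1
            tauto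
          by_cases hy : y ∈ SxAux n (T - t)
          · rw [Set.indicator_of_mem hy, Set.indicator_of_mem (hiff.2 hy)]
            simp [Fin.prod_univ_castSucc, mul_comm]
          · rw [Set.indicator_of_notMem hy, Set.indicator_of_notMem (fun h => hy (hiff.1 h))]
        simp only [this]
        rw [integral_indicator (SxAux_compact _ _).measurableSet, integral_const_mul,
          ih _ _ (sub_nonneg.2 ht.2), ← hN, hc]
        ring
      · rw [Set.indicator_of_notMem ht]
        have : ∀ y : Fin n → ℝ, (SxAux (n+1) T).indicator (fun x => ∏ i, x i ^ m i)
            (Fin.snoc y t) = 0 := by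
          intro y
          refine Set.indicator_of_notMem (fun h => ht ?_) _
          simp only [SxAux, Set.mem_setOf_eq, Fin.forall_fin_succ', Fin.sum_univ_castSucc,
              Fin.snoc_castSucc, Fin.snoc_last] at h
          have := Finset.sum_nonneg (fun i (_ : i ∈ Finset.univ) => h.1.1 i)
          exact ⟨h.1.2, by linarith [h.2]⟩
        simp [this]
    simp only [key]
    rw [integral_indicator measurableSet_Icc, integral_Icc_eq_integral_Ioc,
      ← intervalIntegral.integral_of_le hT, intervalIntegral.integral_const_mul, aux_beta]
    have e : n + 1 + ∑ i, m i = m (Fin.last n) + N + 1 := by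
      rw [Fin.sum_univ_castSucc, hN]; ring
    rw [e, Fin.prod_univ_castSucc, hc]
    have : (N.factorial : ℝ) ≠ 0 := by positivity
    field_simp

lemma aux_m0 (n : ℕ) (T : ℝ) (hT : 0 ≤ T) :
    ∫ _x in SxAux n T, (1:ℝ) = T ^ n / n.factorial := by
  simpa using aux_mono n 0 T hT

lemma aux_m1 (n : ℕ) (T : ℝ) (hT : 0 ≤ T) (k : Fin n) :
    ∫ x in SxAux n T, x k = T ^ (n+1) / (n+1).factorial := by
  have h := aux_mono n (Pi.single k 1) T hT
  have h1 : ∀ x : Fin n → ℝ, ∏ i, x i ^ (Pi.single k 1 : Fin n → ℕ) i = x k := by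
    intro x
    rw [Finset.prod_eq_single k] <;> simp +contextual [Pi.single_apply]
  have h2 : ∏ i, (((Pi.single k 1 : Fin n → ℕ) i).factorial : ℝ) = 1 := by
    rw [Finset.prod_eq_single k] <;> simp +contextual [Pi.single_apply]
  have h3 : ∑ i, (Pi.single k 1 : Fin n → ℕ) i = 1 := by simp
  simp only [h1, h2, h3, mul_one] at h
  exact h

lemma aux_m2 (n : ℕ) (T : ℝ) (hT : 0 ≤ T) (k l : Fin n) :
    ∫ x in SxAux n T, x k * x l = T ^ (n+2) / (n+2).factorial * (1 + if k = l then 1 else 0) := by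
  have h := aux_mono n (Pi.single k 1 + Pi.single l 1) T hT
  have h0 : ∀ k, ∀ x : Fin n → ℝ, ∏ i, x i ^ (Pi.single k 1 : Fin n → ℕ) i = x k := by
    intro k x
    rw [Finset.prod_eq_single k] <;> simp +contextual [Pi.single_apply]
  have h1 : ∀ x : Fin n → ℝ, ∏ i, x i ^ (Pi.single k 1 + Pi.single l 1 : Fin n → ℕ) i = x k * x l := by
    intro x
    simp only [Pi.add_apply, pow_add, Finset.prod_mul_distrib, h0]
  have h2 : ∏ i, (((Pi.single k 1 + Pi.single l 1 : Fin n → ℕ) i).factorial : ℝ)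
      = 1 + if k = l then 1 else 0 := by
    by_cases hkl : k = l
    · subst hkl
      rw [Finset.prod_eq_single k]
      · norm_num
      · intro b _ hb; simp [hb]
      · simp
    · rw [Finset.prod_eq_one]
      · simp [hkl]
      · intro i _
        by_cases h1 : i = k
        · subst h1; simp [hkl]
        · by_cases h2 : i = l
          · subst h2; simp [Pi.single_apply, Ne.symm hkl]
          · simp [h1, h2]
  have h3 : ∑ i, (Pi.single k 1 + Pi.single l 1 : Fin n → ℕ) i = 2 := by
    simp [Finset.sum_add_distrib]
  simp only [h1, h2, h3] at h
  rw [h]; ring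

lemma Delta0_compact (p : ℕ) (a : Fin p → ℤ) (L T : ℝ) : IsCompact (Delta0 p a L T) := by
  refine IsCompact.of_isClosed_subset (isCompact_Icc (a := (0 : Fin (p+1) → ℝ))
    (b := Fin.snoc (fun _ => T) (L + ∑ i, |(a i : ℝ)| * T))) ?_ ?_
  · have : Delta0 p a L T = (⋂ i : Fin p, {x : Fin (p+1) → ℝ | 0 ≤ x i.castSucc}) ∩
        ({x | ∑ i : Fin p, x i.castSucc ≤ T} ∩ ({x | 0 ≤ x (Fin.last p)} ∩
        {x | x (Fin.last p) ≤ L + ∑ i : Fin p, (a i : ℝ) * x i.castSucc})) := by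
      ext x; simp [Delta0]
    rw [this]
    exact (isClosed_iInter fun i => isClosed_le (by fun_prop) (by fun_prop)).inter
      ((isClosed_le (by fun_prop) (by fun_prop)).inter
      ((isClosed_le (by fun_prop) (by fun_prop)).inter (isClosed_le (by fun_prop) (by fun_prop))))
  · intro x hx
    have hb : ∀ i : Fin p, x i.castSucc ≤ T := fun i =>
      (Finset.single_le_sum (f := fun i : Fin p => x i.castSucc)
        (fun j _ => hx.1 j) (Finset.mem_univ i)).trans hx.2.1
    refine ⟨fun i => ?_, fun i => ?_⟩
    · refine Fin.lastCases ?_ (fun i => ?_) i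
      · exact hx.2.2.1
      · exact hx.1 i
    · refine Fin.lastCases ?_ (fun i => ?_) i
      · simp only [Fin.snoc_last]
        refine hx.2.2.2.trans ?_
        gcongr with i _
        · exact hx.1 i
        · exact le_abs_self _
        · exact hb i
      · simpa using hb i

lemma aux_hpos (p : ℕ) (a : Fin p → ℤ) (L T : ℝ)
    (hL : 0 < L) (hT : 0 < T) (ha : ∀ i, 0 < L + (a i : ℝ) * T) (y : Fin p → ℝ)
    (hy : y ∈ SxAux p T) : 0 ≤ L + ∑ i, (a i : ℝ) * y i := by
  have h1 : 0 ≤ ∑ i, (L + (a i : ℝ) * T) * y i :=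
    Finset.sum_nonneg fun i _ => mul_nonneg (ha i).le (hy.1 i)
  have h2 : ∑ i, (L + (a i : ℝ) * T) * y i = L * ∑ i, y i + T * ∑ i, (a i : ℝ) * y i := by
    rw [Finset.mul_sum, Finset.mul_sum, ← Finset.sum_add_distrib]
    exact Finset.sum_congr rfl fun i _ => by ring
  have h3 := mul_le_mul_of_nonneg_left hy.2 hL.le
  have : 0 ≤ T * (L + ∑ i, (a i : ℝ) * y i) := by nlinarith
  exact nonneg_of_mul_nonneg_right this hT

lemma aux_D (p : ℕ) (a : Fin p → ℤ) (L T : ℝ)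
    (hL : 0 < L) (hT : 0 < T) (ha : ∀ i, 0 < L + (a i : ℝ) * T)
    (f : (Fin (p+1) → ℝ) → ℝ) (hf : Continuous f) :
    ∫ x in Delta0 p a L T, f x = ∫ y in SxAux p T,
      ∫ t in (0:ℝ)..(L + ∑ i, (a i : ℝ) * y i), f (Fin.snoc y t) := by
  obtain ⟨h1, h2⟩ := aux_fub (Delta0 p a L T) (Delta0_compact _ _ _ _) f hf
  rw [h1, Measure.volume_eq_prod, integral_prod_symm _ h2,
    ← integral_indicator (SxAux_compact _ _).measurableSet]
  congr 1
  ext y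
  by_cases hy : y ∈ SxAux p T
  · rw [Set.indicator_of_mem hy, intervalIntegral.integral_of_le (aux_hpos p a L T hL hT ha y hy),
      ← integral_Icc_eq_integral_Ioc, ← integral_indicator measurableSet_Icc]
    congr 1
    ext t
    have hiff : (Fin.snoc y t : Fin (p+1) → ℝ) ∈ Delta0 p a L T ↔
        t ∈ Set.Icc 0 (L + ∑ i, (a i : ℝ) * y i) := by
      simp only [Delta0, Set.mem_setOf_eq, Fin.snoc_castSucc, Fin.snoc_last, Set.mem_Icc]
      have := hy.1
      have := hy.2
      tauto
    by_cases ht : t ∈ Set.Icc 0 (L + ∑ i, (a i : ℝ) * y i)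
    · rw [Set.indicator_of_mem ht, Set.indicator_of_mem (hiff.2 ht)]
    · rw [Set.indicator_of_notMem ht, Set.indicator_of_notMem (fun h => ht (hiff.1 h))]
  · rw [Set.indicator_of_notMem hy]
    have : ∀ t : ℝ, (Delta0 p a L T).indicator f (Fin.snoc y t) = 0 := by
      intro t
      refine Set.indicator_of_notMem (fun h => hy ?_) _
      simp only [Delta0, Set.mem_setOf_eq, Fin.snoc_castSucc, Fin.snoc_last] at h
      exact ⟨h.1, h.2.1⟩
    simp [this]

lemma aux_int (n : ℕ) (T : ℝ) (f : (Fin n → ℝ) → ℝ) (hf : Continuous f) :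
    Integrable f (volume.restrict (SxAux n T)) :=
  hf.continuousOn.integrableOn_compact (SxAux_compact n T)

lemma aux_V (p : ℕ) (a : Fin p → ℤ) (L T : ℝ) (hT : 0 < T) :
    ∫ y in SxAux p T, (L + ∑ i, (a i : ℝ) * y i) =
      T ^ p / (p+1).factorial * (L * (p+1) + T * ∑ i, (a i : ℝ)) := by
  rw [integral_add (aux_int _ _ _ (by fun_prop)) (aux_int _ _ _ (by fun_prop)),
    integral_finsetSum _ (fun i _ => aux_int _ _ _ (by fun_prop))]
  have h0 : ∫ _y in SxAux p T, L = L * (T ^ p / p.factorial) := by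
    rw [← aux_m0 p T hT.le, ← integral_const_mul]; simp
  simp only [h0, integral_const_mul, aux_m1 p T hT.le]
  rw [← Finset.sum_mul, Nat.factorial_succ]
  have : (p.factorial : ℝ) ≠ 0 := by positivity
  push_cast
  field_simp
  ring

lemma aux_X (p : ℕ) (a : Fin p → ℤ) (L T : ℝ) (hT : 0 < T) (k : Fin p) :
    ∫ y in SxAux p T, y k * (L + ∑ i, (a i : ℝ) * y i) =
      T ^ (p+1) / (p+2).factorial * (L * (p+2) + T * (∑ i, (a i : ℝ) + a k)) := by
  have e : ∀ y : Fin p → ℝ, y k * (L + ∑ i, (a i : ℝ) * y i) =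
      L * y k + ∑ i, (a i : ℝ) * (y k * y i) := by
    intro y
    rw [mul_add, Finset.mul_sum, mul_comm L]
    congr 1
    exact Finset.sum_congr rfl fun i _ => by ring
  simp only [e]
  rw [integral_add (aux_int _ _ _ (by fun_prop)) (aux_int _ _ _ (by fun_prop)),
    integral_finsetSum _ (fun i _ => aux_int _ _ _ (by fun_prop))]
  simp only [integral_const_mul, aux_m1 p T hT.le, aux_m2 p T hT.le]
  have e2 : ∑ i, (a i : ℝ) * (T ^ (p+2) / (p+2).factorial * (1 + if k = i then 1 else 0)) =
      T ^ (p+2) / (p+2).factorial * (∑ i, (a i : ℝ) + a k) := by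
    rw [mul_add, Finset.mul_sum]
    simp only [mul_add, Finset.sum_add_distrib, mul_ite, mul_one, mul_zero, Finset.sum_ite_eq,
      Finset.mem_univ, if_true]
    simp only [mul_comm]
  rw [e2, Nat.factorial_succ (p+1)]
  have : ((p+1).factorial : ℝ) ≠ 0 := by positivity
  push_cast
  field_simp
  ring

lemma aux_H (p : ℕ) (a : Fin p → ℤ) (L T : ℝ) (hT : 0 < T) :
    ∫ y in SxAux p T, (L + ∑ i, (a i : ℝ) * y i) ^ 2 =
      T ^ p / (p+2).factorial * (((p : ℝ) + 1) * ((p : ℝ) + 2) * L ^ 2 +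
            2 * ((p : ℝ) + 2) * (∑ i : Fin p, (a i : ℝ)) * L * T +
            ((∑ i : Fin p, (a i : ℝ) ^ 2) + (∑ i : Fin p, (a i : ℝ)) ^ 2) * T ^ 2) := by
  have e : ∀ y : Fin p → ℝ, (L + ∑ i, (a i : ℝ) * y i) ^ 2 =
      L * (L + ∑ i, (a i : ℝ) * y i) + ∑ k, (a k : ℝ) * (y k * (L + ∑ i, (a i : ℝ) * y i)) := by
    intro y
    simp only [← mul_assoc]
    rw [← Finset.sum_mul]
    ring
  simp only [e]
  rw [integral_add (aux_int _ _ _ (by fun_prop)) (aux_int _ _ _ (by fun_prop)),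
    integral_finsetSum _ (fun i _ => aux_int _ _ _ (by fun_prop))]
  simp only [integral_const_mul, aux_V p a L T hT, aux_X p a L T hT]
  have e2 : ∑ k, (a k : ℝ) * (T ^ (p+1) / (p+2).factorial *
      (L * (p+2) + T * (∑ i, (a i : ℝ) + a k))) =
      T ^ (p+1) / (p+2).factorial * ((∑ i, (a i : ℝ)) * (L * (p+2) + T * ∑ i, (a i : ℝ)) +
        T * ∑ i, (a i : ℝ) ^ 2) := by
    generalize hB : (∑ i, (a i : ℝ)) = B
    nth_rewrite 2 [← hB]
    rw [Finset.sum_mul, Finset.mul_sum Finset.univ _ T, ← Finset.sum_add_distrib, Finset.mul_sum]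
    exact Finset.sum_congr rfl fun i _ => by ring
  rw [e2, Nat.factorial_succ (p+1)]
  have : ((p+1).factorial : ℝ) ≠ 0 := by positivity
  push_cast
  field_simp
  ring

theorem stmt14 (p : ℕ) (hp : 1 < p) (a : Fin p → ℤ) (L T : ℝ)
    (hL : 0 < L) (hT : 0 < T) (ha : ∀ i, 0 < L + (a i : ℝ) * T) :
    (∀ k : Fin p,
      Cm (Delta0 p a L T) k.castSucc =
        (T / ((p : ℝ) + 2)) *
          ((L * ((p : ℝ) + 2) + T * ((∑ i : Fin p, (a i : ℝ)) + (a k : ℝ))) /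
            (L * ((p : ℝ) + 1) + T * ∑ i : Fin p, (a i : ℝ)))) ∧
    Cm (Delta0 p a L T) (Fin.last p) =
      (1 / 2) *
        ((((p : ℝ) + 1) * ((p : ℝ) + 2) * L ^ 2 +
            2 * ((p : ℝ) + 2) * (∑ i : Fin p, (a i : ℝ)) * L * T +
            ((∑ i : Fin p, (a i : ℝ) ^ 2) + (∑ i : Fin p, (a i : ℝ)) ^ 2) * T ^ 2) /
          (((p : ℝ) + 2) * (((p : ℝ) + 1) * L + (∑ i : Fin p, (a i : ℝ)) * T))) := by
  have hA : 0 < L * ((p : ℝ) + 1) + T * ∑ i : Fin p, (a i : ℝ) := by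
    have h1 : 0 ≤ ∑ i : Fin p, (L + (a i : ℝ) * T) := Finset.sum_nonneg fun i _ => (ha i).le
    rw [Finset.sum_add_distrib, ← Finset.sum_mul] at h1
    simp at h1
    nlinarith
  have hcomp : ∀ k, Cm (Delta0 p a L T) k =
      (∫ x in Delta0 p a L T, (1:ℝ))⁻¹ * ∫ x in Delta0 p a L T, x k := by
    intro k
    have hI : Integrable (fun x : Fin (p+1) → ℝ => x) (volume.restrict (Delta0 p a L T)) :=
      continuous_id.continuousOn.integrableOn_compact (Delta0_compact p a L T)
    have := (ContinuousLinearMap.proj (R := ℝ) (φ := fun _ : Fin (p+1) => ℝ) k).integral_comp_comm hI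
    simp only [ContinuousLinearMap.proj_apply] at this
    rw [this]
    simp [Cm]
  have hV : ∫ x in Delta0 p a L T, (1:ℝ) =
      T ^ p / (p+1).factorial * (L * (p+1) + T * ∑ i, (a i : ℝ)) := by
    rw [aux_D p a L T hL hT ha _ (by fun_prop), ← aux_V p a L T hT]
    simp
  have hf : ((p+1).factorial : ℝ) ≠ 0 := by positivity
  have hp2 : (p:ℝ) + 2 ≠ 0 := by positivity
  have hA' := hA.ne'
  constructor
  · intro k
    have hX : ∫ x in Delta0 p a L T, x k.castSucc =
        T ^ (p+1) / (p+2).factorial * (L * (p+2) + T * (∑ i, (a i : ℝ) + a k)) := by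
      rw [aux_D p a L T hL hT ha _ (by fun_prop), ← aux_X p a L T hT]
      simp [mul_comm]
    rw [hcomp, hV, hX, Nat.factorial_succ (p+1)]
    generalize (∑ i, (a i : ℝ)) = A at *
    push_cast
    have : (p:ℝ) + 1 + 1 = p + 2 := by ring
    rw [this]
    field_simp
    ring
  · have hX : ∫ x in Delta0 p a L T, x (Fin.last p) =
        (1/2) * ∫ y in SxAux p T, (L + ∑ i, (a i : ℝ) * y i) ^ 2 := by
      rw [aux_D p a L T hL hT ha _ (by fun_prop), ← integral_const_mul]
      simp only [Fin.snoc_last, integral_id]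
      congr 1
      ext y
      ring
    rw [hcomp, hV, hX, aux_H p a L T hT, Nat.factorial_succ (p+1)]
    generalize (∑ i, (a i : ℝ)) = A at *
    push_cast
    have : (p:ℝ) + 1 + 1 = p + 2 := by ring
    rw [this]
    have h5 : ((p:ℝ) + 1) * L + A * T = L * (p + 1) + T * A := by ring
    rw [h5]
    field_simp
end
end

section
/- Let p > 1 be an integer, a = (a_1,…,a_p) ∈ ℤ^p, and λ, τ > 0 with λ + a_i τ > 0 for all i. In ℝ^{p+1} with standard basis e_1,…,e_{p+1}, let n_i = −e_i for i = 1,…,p, n_{p+1} = ∑_{i=1}^p e_i, n_{p+2} = −e_{p+1}, n_{p+3} = e_{p+1} − ∑_{i=1}^p a_i e_i, and let Δ = Δ(k⁰) with k⁰ = (0,…,0, τ, 0, λ). If b ∈ ℤ^{p+1} and (Δ, b) is a mass linear pair with ⟨Cm(Δ(k)), b⟩ = ∑_{j=1}^{p+3} R_j k_j + C on C_Δ, then ∑_{j=1}^{p+3} R_j = 0. -/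
open MeasureTheory

noncomputable section

/-- Euclidean inner product on ℝⁿ. -/
def dot {n : ℕ} (x y : Fin n → ℝ) : ℝ := ∑ i, x i * y i

/-- The polytope `Δ(k) = ⋂_j {x : ⟨x, n_j⟩ ≤ k_j}` determined by conormals `N` and
support numbers `k`. -/
def PolyDelta {n m : ℕ} (N : Fin m → Fin n → ℝ) (k : Fin m → ℝ) : Set (Fin n → ℝ) :=
  {x | ∀ j, dot x (N j) ≤ k j}

/-- The facet `F_j(k) = Δ(k) ∩ {x : ⟨x, n_j⟩ = k_j}`. -/
def PolyFacet {n m : ℕ} (N : Fin m → Fin n → ℝ) (k : Fin m → ℝ) (j : Fin m) :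
    Set (Fin n → ℝ) :=
  {x ∈ PolyDelta N k | dot x (N j) = k j}

/-- The chamber of the polytope `Δ(k⁰)`: those `k` for which the combinatorics of the
facets of `Δ(k)` agrees with that of `Δ(k⁰)`. -/
def chamber {n m : ℕ} (N : Fin m → Fin n → ℝ) (k0 : Fin m → ℝ) : Set (Fin m → ℝ) :=
  {k | ∀ J : Finset (Fin m),
    (⋂ j ∈ J, PolyFacet N k j).Nonempty ↔ (⋂ j ∈ J, PolyFacet N k0 j).Nonempty}

/-- `(Δ(k⁰), b)` is a mass linear pair: `⟨Cm(Δ(k)), b⟩` is an (affine) linear function of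
`k` on the chamber of `Δ(k⁰)`. -/
def IsMassLinear {n m : ℕ} (N : Fin m → Fin n → ℝ) (k0 : Fin m → ℝ) (b : Fin n → ℝ) :
    Prop :=
  ∃ (R : Fin m → ℝ) (C : ℝ), ∀ k ∈ chamber N k0,
    dot (Cm (PolyDelta N k)) b = (∑ j, R j * k j) + C

/-- `Δ(k)` is a Delzant polytope: each conormal is a primitive integer vector, exactly `n`
facets meet at each vertex, and the conormals of the facets through any vertex form a
ℤ-basis of ℤⁿ (an integer matrix of determinant ±1). -/
def IsDelzant {n m : ℕ} (N : Fin m → Fin n → ℝ) (k : Fin m → ℝ) : Prop :=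
  (∀ j, ∃ z : Fin n → ℤ, (∀ i, N j i = (z i : ℝ)) ∧ Finset.univ.gcd z = 1) ∧
  ∀ v ∈ Set.extremePoints ℝ (PolyDelta N k),
    ∃ J : Finset (Fin m), J.card = n ∧ (∀ j, j ∈ J ↔ dot v (N j) = k j) ∧
      ∃ e : Fin n → Fin m, (∀ i, e i ∈ J) ∧ Function.Injective e ∧
        |(Matrix.of fun i i' => N (e i) i').det| = 1

/-- Conormals of the Δ_p bundle over Δ_1: `n_i = -e_i` for `i < p`, `n_{p+1} = ∑_{i<p} e_i`,
`n_{p+2} = -e_{p+1}`, `n_{p+3} = e_{p+1} - ∑ a_i e_i`. -/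
def bundleN (p : ℕ) (a : Fin p → ℤ) : Fin (p + 3) → Fin (p + 1) → ℝ := fun j i =>
  if (j : ℕ) < p then (if (i : ℕ) = (j : ℕ) then -1 else 0)
  else if (j : ℕ) = p then (if (i : ℕ) < p then 1 else 0)
  else if (j : ℕ) = p + 1 then (if (i : ℕ) = p then -1 else 0)
  else if (i : ℕ) = p then 1
  else if h : (i : ℕ) < p then -((a ⟨i, h⟩ : ℝ))
  else 0

/-- Support numbers `k⁰ = (0,…,0,τ,0,λ)` of the Δ_p bundle over Δ_1. -/
def bundleK (p : ℕ) (L T : ℝ) : Fin (p + 3) → ℝ := fun j =>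
  if (j : ℕ) = p then T else if (j : ℕ) = p + 2 then L else 0


/-- good sum of casts -/
def ell {p : ℕ} (a : Fin p → ℤ) (x : Fin p → ℝ) : ℝ := ∑ i, (a i : ℝ) * x i

theorem dot_lt {p : ℕ} (a : Fin p → ℤ) (x : Fin (p+1) → ℝ) (i : Fin p) (h : (i:ℕ) < p + 3) :
    dot x (bundleN p a ⟨i, h⟩) = - x i.castSucc := by
  unfold dot bundleN
  rw [Finset.sum_eq_single i.castSucc]
  · simp
  · intro j _ hj
    have : (j:ℕ) ≠ i := fun hh => hj (Fin.ext hh)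
    simp [this]
  · simp

theorem dot_p {p : ℕ} (a : Fin p → ℤ) (x : Fin (p+1) → ℝ) (h : p < p + 3) :
    dot x (bundleN p a ⟨p, h⟩) = ∑ i : Fin p, x i.castSucc := by
  unfold dot bundleN
  rw [Fin.sum_univ_castSucc]
  simp

theorem dot_p1 {p : ℕ} (a : Fin p → ℤ) (x : Fin (p+1) → ℝ) (h : p + 1 < p + 3) :
    dot x (bundleN p a ⟨p + 1, h⟩) = - x (Fin.last p) := by
  unfold dot bundleN
  rw [Fin.sum_univ_castSucc]
  simp
  apply Finset.sum_eq_zero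
  intro i _
  simp [i.2.ne]

theorem dot_p2 {p : ℕ} (a : Fin p → ℤ) (x : Fin (p+1) → ℝ) (h : p + 2 < p + 3) :
    dot x (bundleN p a ⟨p + 2, h⟩) = x (Fin.last p) - ell a (fun i => x i.castSucc) := by
  unfold dot bundleN ell
  rw [Fin.sum_univ_castSucc]
  simp [add_comm, sub_eq_add_neg, ← Finset.sum_neg_distrib]
  apply Finset.sum_congr rfl
  intro i _
  simp [i.2.ne, mul_comm]

theorem forall_idx {p : ℕ} (P : Fin (p+3) → Prop) :
    (∀ j, P j) ↔ (∀ i : Fin p, P ⟨i, by omega⟩) ∧ P ⟨p, by omega⟩ ∧ P ⟨p+1, by omega⟩ ∧ P ⟨p+2, by omega⟩ := by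
  constructor
  · intro h
    exact ⟨fun i => h _, h _, h _, h _⟩
  · rintro ⟨h1, h2, h3, h4⟩ ⟨j, hj⟩
    rcases lt_or_ge j p with h | h
    · exact h1 ⟨j, h⟩
    · obtain h | h | h : j = p ∨ j = p + 1 ∨ j = p + 2 := by omega
      all_goals subst h; assumption

theorem sum_idx {p : ℕ} (f : Fin (p+3) → ℝ) :
    ∑ j, f j = (∑ i : Fin p, f ⟨i, by omega⟩) + f ⟨p, by omega⟩ + f ⟨p+1, by omega⟩ + f ⟨p+2, by omega⟩ := by
  rw [Fin.sum_univ_castSucc, Fin.sum_univ_castSucc, Fin.sum_univ_castSucc]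
  rfl

theorem bK_lt {p : ℕ} (L T : ℝ) (i : Fin p) (h : (i:ℕ) < p + 3) : bundleK p L T ⟨i, h⟩ = 0 := by
  have := i.2
  simp [bundleK, this.ne, show (i:ℕ) ≠ p + 2 by omega]
theorem bK_p {p : ℕ} (L T : ℝ) (h : p < p + 3) : bundleK p L T ⟨p, h⟩ = T := by
  simp [bundleK]
theorem bK_p1 {p : ℕ} (L T : ℝ) (h : p + 1 < p + 3) : bundleK p L T ⟨p + 1, h⟩ = 0 := by
  simp [bundleK]
theorem bK_p2 {p : ℕ} (L T : ℝ) (h : p + 2 < p + 3) : bundleK p L T ⟨p + 2, h⟩ = L := by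
  simp [bundleK]

theorem mem_D {p : ℕ} (a : Fin p → ℤ) (L T : ℝ) (x : Fin (p+1) → ℝ) :
    x ∈ PolyDelta (bundleN p a) (bundleK p L T) ↔
      (∀ i : Fin p, 0 ≤ x i.castSucc) ∧ (∑ i : Fin p, x i.castSucc ≤ T) ∧ 0 ≤ x (Fin.last p) ∧
        x (Fin.last p) ≤ L + ell a (fun i => x i.castSucc) := by
  unfold PolyDelta
  rw [Set.mem_ofPred_eq, forall_idx]
  simp only [dot_lt, dot_p, dot_p1, dot_p2, bK_lt, bK_p, bK_p1, bK_p2, neg_nonpos, sub_le_iff_le_add]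

theorem h_pos {p : ℕ} (a : Fin p → ℤ) (L T : ℝ) (hL : 0 < L) (hT : 0 < T)
    (ha : ∀ i, 0 < L + (a i : ℝ) * T) (x : Fin p → ℝ) (hx : ∀ i, 0 ≤ x i) (hs : ∑ i, x i ≤ T) :
    0 < L + ell a x := by
  have h1 : T * (L + ell a x) = L * (T - ∑ i, x i) + ∑ i, (L + (a i : ℝ) * T) * x i := by
    simp only [ell, add_mul, Finset.sum_add_distrib, ← Finset.mul_sum, mul_add, mul_sub]
    have : ∑ i, (a i : ℝ) * T * x i = T * ∑ i, (a i : ℝ) * x i := by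
      rw [Finset.mul_sum]; exact Finset.sum_congr rfl fun i _ => by ring
    rw [this]; ring
  have h2 : ∀ i, 0 ≤ (L + (a i : ℝ) * T) * x i := fun i => mul_nonneg (ha i).le (hx i)
  have h3 : 0 < T * (L + ell a x) := by
    rw [h1]
    rcases hs.lt_or_eq with h | h
    · have := Finset.sum_nonneg (s := Finset.univ) fun i _ => h2 i
      have : 0 < L * (T - ∑ i, x i) := mul_pos hL (by linarith)
      linarith
    · have : 0 < ∑ i, (L + (a i : ℝ) * T) * x i := by
        obtain ⟨i, _, hi⟩ : ∃ i ∈ Finset.univ, 0 < x i := by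
          by_contra hc
          push Not at hc
          have := Finset.sum_nonpos hc
          linarith
        exact Finset.sum_pos' (fun i _ => h2 i) ⟨i, Finset.mem_univ _, mul_pos (ha i) hi⟩
      rw [h]; simpa using this
  exact (mul_pos_iff_of_pos_left hT).1 h3

theorem inter_iff {p : ℕ} (a : Fin p → ℤ) (L T : ℝ) (hL : 0 < L) (hT : 0 < T)
    (ha : ∀ i, 0 < L + (a i : ℝ) * T) (J : Finset (Fin (p+3))) :
    (⋂ j ∈ J, PolyFacet (bundleN p a) (bundleK p L T) j).Nonempty ↔
      (J = ∅ ∨ (¬ ((∀ i : Fin p, (⟨i, by omega⟩ : Fin (p+3)) ∈ J) ∧ (⟨p, by omega⟩ : Fin (p+3)) ∈ J) ∧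
      ¬ ((⟨p+1, by omega⟩ : Fin (p+3)) ∈ J ∧ (⟨p+2, by omega⟩ : Fin (p+3)) ∈ J))) := by
  constructor
  · rintro ⟨x, hx⟩
    rcases J.eq_empty_or_nonempty with h | ⟨j, hj⟩
    · exact Or.inl h
    right
    simp only [Set.mem_iInter] at hx
    have hD := (hx j hj).1
    rw [mem_D] at hD
    obtain ⟨h1, h2, h3, h4⟩ := hD
    have hp := h_pos a L T hL hT ha _ h1 h2
    constructor
    · rintro ⟨g1, g2⟩
      have e1 := fun i => (hx _ (g1 i)).2
      have e2 := (hx _ g2).2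
      simp only [dot_lt, dot_p, bK_lt, bK_p, neg_eq_zero] at e1 e2
      simp only [e1, Finset.sum_const_zero] at e2
      linarith
    · rintro ⟨g1, g2⟩
      have e1 := (hx _ g1).2
      have e2 := (hx _ g2).2
      simp only [dot_p1, dot_p2, bK_p1, bK_p2, neg_eq_zero] at e1 e2
      linarith
  · rintro (h | ⟨h1, h2⟩)
    · subst h; simp
    have hx : ∃ x : Fin p → ℝ, (∀ i, 0 ≤ x i) ∧ (∑ i, x i ≤ T) ∧
        (∀ i : Fin p, (⟨i, by omega⟩ : Fin (p+3)) ∈ J → x i = 0) ∧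
        ((⟨p, by omega⟩ : Fin (p+3)) ∈ J → ∑ i, x i = T) := by
      by_cases h : (⟨p, by omega⟩ : Fin (p+3)) ∈ J
      · have : ∃ i : Fin p, (⟨i, by omega⟩ : Fin (p+3)) ∉ J := by
          by_contra hc
          push Not at hc
          exact h1 ⟨hc, h⟩
        obtain ⟨i, hi⟩ := this
        refine ⟨Pi.single i T, ?_, ?_, ?_, ?_⟩
        · intro j
          by_cases hj : j = i
          · subst hj; simp [hT.le]
          · simp [hj]
        · simp
        · intro j hj
          have : j ≠ i := by rintro rfl; exact hi hj
          simp [this]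
        · simp
      · exact ⟨0, by simp, by simp [hT.le], by simp, fun h' => absurd h' h⟩
    obtain ⟨x, x1, x2, x3, x4⟩ := hx
    have hp := h_pos a L T hL hT ha _ x1 x2
    have hy : ∃ y : ℝ, 0 ≤ y ∧ y ≤ L + ell a x ∧ ((⟨p+1, by omega⟩ : Fin (p+3)) ∈ J → y = 0) ∧
        ((⟨p+2, by omega⟩ : Fin (p+3)) ∈ J → y = L + ell a x) := by
      by_cases h : (⟨p+1, by omega⟩ : Fin (p+3)) ∈ J
      · exact ⟨0, le_rfl, hp.le, fun _ => rfl, fun h' => absurd ⟨h, h'⟩ h2⟩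
      · exact ⟨L + ell a x, hp.le, le_rfl, fun h' => absurd h' h, fun _ => rfl⟩
    obtain ⟨y, y1, y2, y3, y4⟩ := hy
    refine ⟨Fin.snoc (α := fun _ => ℝ) x y, ?_⟩
    simp only [Set.mem_iInter]
    have hD : (Fin.snoc (α := fun _ => ℝ) x y) ∈ PolyDelta (bundleN p a) (bundleK p L T) := by
      rw [mem_D]
      simp only [Fin.snoc_castSucc, Fin.snoc_last]
      exact ⟨x1, x2, y1, y2⟩
    rw [forall_idx]
    refine ⟨fun i hi => ⟨hD, ?_⟩, fun hi => ⟨hD, ?_⟩, fun hi => ⟨hD, ?_⟩, fun hi => ⟨hD, ?_⟩⟩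
    · simp [dot_lt, bK_lt, x3 i hi]
    · simp [dot_p, bK_p, x4 hi]
    · simp [dot_p1, bK_p1, y3 hi]
    · simp [dot_p2, bK_p2, y4 hi]

theorem mem_chamber {p : ℕ} (a : Fin p → ℤ) (L T : ℝ) (hL : 0 < L) (hT : 0 < T)
    (ha : ∀ i, 0 < L + (a i : ℝ) * T) (L' T' : ℝ) (hL' : 0 < L') (hT' : 0 < T')
    (ha' : ∀ i, 0 < L' + (a i : ℝ) * T') :
    bundleK p L' T' ∈ chamber (bundleN p a) (bundleK p L T) := by
  intro J
  rw [inter_iff a L T hL hT ha, inter_iff a L' T' hL' hT' ha']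

theorem dot_add {n : ℕ} (x y z : Fin n → ℝ) : dot (x + y) z = dot x z + dot y z := by
  simp [dot, add_mul, Finset.sum_add_distrib]

theorem mem_shift {n m : ℕ} (N : Fin m → Fin n → ℝ) (k : Fin m → ℝ) (v x : Fin n → ℝ) :
    x + v ∈ PolyDelta N (fun j => k j + dot v (N j)) ↔ x ∈ PolyDelta N k := by
  simp [PolyDelta, dot_add]

theorem facet_shift {n m : ℕ} (N : Fin m → Fin n → ℝ) (k : Fin m → ℝ) (v x : Fin n → ℝ) (j : Fin m) :
    x + v ∈ PolyFacet N (fun j => k j + dot v (N j)) j ↔ x ∈ PolyFacet N k j := by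
  simp [PolyFacet, mem_shift, dot_add]

theorem chamber_shift {n m : ℕ} (N : Fin m → Fin n → ℝ) (k k0 : Fin m → ℝ) (v : Fin n → ℝ)
    (h : k ∈ chamber N k0) : (fun j => k j + dot v (N j)) ∈ chamber N k0 := by
  intro J
  rw [← h J]
  constructor
  · rintro ⟨x, hx⟩
    refine ⟨x - v, ?_⟩
    simp only [Set.mem_iInter] at hx ⊢
    intro j hj
    rw [← facet_shift N k v, sub_add_cancel]
    exact hx j hj
  · rintro ⟨x, hx⟩
    refine ⟨x + v, ?_⟩
    simp only [Set.mem_iInter] at hx ⊢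
    intro j hj
    rw [facet_shift]
    exact hx j hj

/-- the base simplex -/
def simp0 (p : ℕ) (T : ℝ) : Set (Fin p → ℝ) := {x | (∀ i, 0 ≤ x i) ∧ ∑ i, x i ≤ T}

theorem simp0_compact (p : ℕ) (T : ℝ) : IsCompact (simp0 p T) := by
  refine IsCompact.of_isClosed_subset (isCompact_Icc (a := (0 : Fin p → ℝ)) (b := fun _ => T)) ?_ ?_
  · have : simp0 p T = (⋂ i, {x : Fin p → ℝ | 0 ≤ x i}) ∩ {x | ∑ i, x i ≤ T} := by
      ext x; simp [simp0]
    rw [this]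
    refine IsClosed.inter (isClosed_iInter fun i => ?_) ?_
    · exact isClosed_le (by fun_prop) (by fun_prop)
    · exact isClosed_le (by fun_prop) (by fun_prop)
  · rintro x ⟨h1, h2⟩
    exact ⟨h1, fun i => (Finset.single_le_sum (fun j _ => h1 j) (Finset.mem_univ i)).trans h2⟩

theorem ell_cont {p : ℕ} (a : Fin p → ℤ) : Continuous (ell a) := by
  unfold ell; fun_prop

theorem mem_D' {p : ℕ} (a : Fin p → ℤ) (L T : ℝ) (x : Fin p → ℝ) (y : ℝ) :
    Fin.snoc (α := fun _ => ℝ) x y ∈ PolyDelta (bundleN p a) (bundleK p L T) ↔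
      x ∈ simp0 p T ∧ y ∈ Set.Icc 0 (L + ell a x) := by
  rw [mem_D]
  simp only [Fin.snoc_castSucc, Fin.snoc_last, simp0, Set.mem_Icc, Set.mem_ofPred_eq, and_assoc]

theorem D_compact {p : ℕ} (a : Fin p → ℤ) (L T : ℝ) :
    IsCompact (PolyDelta (bundleN p a) (bundleK p L T)) := by
  obtain ⟨M, hM⟩ := (simp0_compact p T).bddAbove_image (f := fun x => L + ell a x)
    (continuous_const.add (ell_cont a)).continuousOn
  refine IsCompact.of_isClosed_subset
    (isCompact_Icc (a := (0 : Fin (p+1) → ℝ)) (b := fun _ => max T M)) ?_ ?_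
  · have : PolyDelta (bundleN p a) (bundleK p L T) =
      ⋂ j, {x | dot x (bundleN p a j) ≤ bundleK p L T j} := by
      ext x; simp [PolyDelta]
    rw [this]
    refine isClosed_iInter fun i => ?_
    exact isClosed_le (by unfold dot; fun_prop) (by fun_prop)
  · intro x hx
    rw [mem_D] at hx
    obtain ⟨h1, h2, h3, h4⟩ := hx
    constructor
    · intro i
      refine Fin.lastCases ?_ (fun i => ?_) i
      · exact h3
      · exact h1 i
    · intro i
      refine Fin.lastCases ?_ (fun i => ?_) i
      · refine le_max_of_le_right (h4.trans ?_)
        exact hM ⟨fun i => x i.castSucc, ⟨h1, h2⟩, rfl⟩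
      · refine le_max_of_le_left ?_
        exact (Finset.single_le_sum (f := fun i : Fin p => x i.castSucc) (fun j _ => h1 j) (Finset.mem_univ i)).trans h2

theorem fubini {p : ℕ} (a : Fin p → ℤ) (L T : ℝ) (hL : 0 < L) (hT : 0 < T)
    (ha : ∀ i, 0 < L + (a i : ℝ) * T) (g : (Fin (p+1) → ℝ) → ℝ) (hg : Continuous g) :
    ∫ x in PolyDelta (bundleN p a) (bundleK p L T), g x =
      ∫ x in simp0 p T, ∫ y in (0:ℝ)..(L + ell a x), g (Fin.snoc (α := fun _ => ℝ) x y) := by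
  set D := PolyDelta (bundleN p a) (bundleK p L T) with hDdef
  have hDc : IsCompact D := D_compact a L T
  have hmp := (volume_preserving_piFinSuccAbove (fun _ : Fin (p+1) => ℝ) (Fin.last p)).symm
  have hint : Integrable (D.indicator g) volume :=
    (hg.continuousOn.integrableOn_compact hDc).integrable_indicator hDc.measurableSet
  have he : ∀ z : ℝ × (Fin p → ℝ), (MeasurableEquiv.piFinSuccAbove (fun _ : Fin (p+1) => ℝ) (Fin.last p)).symm z
      = Fin.snoc (α := fun _ => ℝ) z.2 z.1 := by
    intro z
    exact Fin.insertNth_last' z.1 z.2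
  rw [← integral_indicator hDc.measurableSet]
  rw [← hmp.integral_comp (MeasurableEquiv.measurableEmbedding _)]
  have hint2 := (hmp.integrable_comp_emb (MeasurableEquiv.measurableEmbedding _)).2 hint
  rw [Measure.volume_eq_prod] at hint2 ⊢
  refine (integral_prod_symm _ hint2).trans ?_
  simp only [Function.comp]
  rw [← integral_indicator (simp0_compact p T).measurableSet]
  congr 1
  ext x
  by_cases hx : x ∈ simp0 p T
  · rw [Set.indicator_of_mem hx, intervalIntegral.integral_of_le (h_pos a L T hL hT ha x hx.1 hx.2).le,
      ← integral_Icc_eq_integral_Ioc, ← integral_indicator measurableSet_Icc]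
    congr 1
    ext y
    rw [he]
    by_cases hy : y ∈ Set.Icc 0 (L + ell a x)
    · rw [Set.indicator_of_mem hy, Set.indicator_of_mem ((mem_D' a L T x y).2 ⟨hx, hy⟩)]
    · rw [Set.indicator_of_notMem hy, Set.indicator_of_notMem]
      exact fun h => hy ((mem_D' a L T x y).1 h).2
  · rw [Set.indicator_of_notMem hx]
    refine integral_eq_zero_of_ae (Filter.Eventually.of_forall fun y => ?_)
    simp only [Pi.zero_apply]
    rw [he, Set.indicator_of_notMem]
    exact fun h => hx ((mem_D' a L T x y).1 h).1

/-- reflection -/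
def refl0 {p : ℕ} (j : Fin p) : (Fin p → ℝ) →ₗ[ℝ] (Fin p → ℝ) where
  toFun x := Function.update x j (-∑ i, x i)
  map_add' x y := by
    ext i
    by_cases h : i = j
    · subst h; simp [Finset.sum_add_distrib]; ring
    · simp [h]
  map_smul' c x := by
    ext i
    by_cases h : i = j
    · subst h; simp [Finset.mul_sum]
    · simp [h]

theorem sum_update0 {p : ℕ} (j : Fin p) (x : Fin p → ℝ) (c : ℝ) :
    ∑ i, Function.update x j c i = c + (∑ i, x i - x j) := by
  rw [Finset.sum_update_of_mem (Finset.mem_univ j), ← Finset.erase_eq, ]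
  have := Finset.add_sum_erase Finset.univ x (Finset.mem_univ j)
  linarith

theorem refl0_mp {p : ℕ} (j : Fin p) : MeasurePreserving (refl0 j) volume volume := by
  have h1 : (refl0 j) * (refl0 j) = 1 := by
    apply LinearMap.ext
    intro x
    change Function.update (Function.update x j (-∑ i, x i)) j (-∑ i, Function.update x j (-∑ i, x i) i) = x
    rw [sum_update0]
    simp
  have h2 : LinearMap.det (refl0 j) * LinearMap.det (refl0 j) = 1 := by
    rw [← map_mul, h1, map_one]
  refine ⟨(LinearMap.continuous_of_finiteDimensional _).measurable, ?_⟩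
  have h3 : |LinearMap.det (refl0 j)| = 1 := by
    have := mul_self_eq_one_iff.1 h2
    rcases this with h | h <;> simp [h]
  rw [Measure.map_linearMap_addHaar_eq_smul_addHaar]
  · rw [abs_inv, h3]; simp
  · intro h; simp [h] at h2

/-- affine reflection -/
def refl1 {p : ℕ} (T : ℝ) (j : Fin p) (x : Fin p → ℝ) : Fin p → ℝ :=
  Function.update x j (T - ∑ i, x i)

theorem refl1_mp {p : ℕ} (T : ℝ) (j : Fin p) : MeasurePreserving (refl1 T j) volume volume := by
  have : refl1 T j = (fun x => x + Pi.single j T) ∘ (refl0 j) := by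
    ext x i
    simp only [refl1, refl0, Function.comp]
    by_cases h : i = j
    · subst h; simp; ring
    · simp [h]
  rw [this]
  exact (measurePreserving_add_right volume (Pi.single j T)).comp (refl0_mp j)

theorem refl1_inv {p : ℕ} (T : ℝ) (j : Fin p) : Function.Involutive (refl1 T j) := by
  intro x
  unfold refl1
  rw [sum_update0]
  simp

theorem intOn {p : ℕ} (T : ℝ) (g : (Fin p → ℝ) → ℝ) (hg : Continuous g) : IntegrableOn g (simp0 p T) :=
  hg.continuousOn.integrableOn_compact (simp0_compact p T)

theorem moment_refl {p : ℕ} (T : ℝ) (j : Fin p) :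
    ∫ x in simp0 p T, x j = T * volume.real (simp0 p T) - ∑ i, ∫ x in simp0 p T, x i := by
  have hpre : refl1 T j ⁻¹' simp0 p T = simp0 p T := by
    have key : ∀ x ∈ simp0 p T, refl1 T j x ∈ simp0 p T := by
      rintro x ⟨h1, h2⟩
      constructor
      · intro i
        unfold refl1
        by_cases h : i = j
        · subst h; simpa using h2
        · simpa [h] using h1 i
      · unfold refl1
        rw [sum_update0]
        linarith [h1 j]
    ext x
    constructor
    · intro h
      have := key _ h
      rwa [refl1_inv] at this
    · exact key x
  have hemb : MeasurableEmbedding (refl1 T j) :=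
    (MeasurableEquiv.ofInvolutive (refl1 T j) (refl1_inv T j) (refl1_mp T j).measurable).measurableEmbedding
  have h := (refl1_mp T j).setIntegral_preimage_emb hemb (fun x => x j) (simp0 p T)
  rw [hpre] at h
  rw [← h]
  simp only [refl1, Function.update_self]
  rw [integral_sub (intOn T (fun _ => T) (by fun_prop)) (intOn T (fun x => ∑ i, x i) (by fun_prop)),
    integral_finsetSum _ (fun i _ => intOn T (fun x => x i) (by fun_prop))]
  simp [mul_comm]

theorem moment {p : ℕ} (T : ℝ) (j : Fin p) :
    ∫ x in simp0 p T, x j = T * volume.real (simp0 p T) / (p + 1) := by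
  have h := moment_refl (p := p) T
  set M := ∑ i, ∫ x in simp0 p T, x i with hM
  have h2 : M = p * (T * volume.real (simp0 p T) - M) := by
    conv_lhs => rw [hM, Finset.sum_congr rfl (fun i _ => h i)]
    simp
    ring
  rw [h j]
  field_simp
  linarith

theorem vol_pos {p : ℕ} (T : ℝ) (hT : 0 < T) : 0 < volume.real (simp0 p T) := by
  rw [Measure.real, ENNReal.toReal_pos_iff]
  refine ⟨?_, (simp0_compact p T).measure_lt_top⟩
  have hsub : Set.Icc (0 : Fin p → ℝ) (fun _ => T / (p + 1)) ⊆ simp0 p T := by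
    rintro x ⟨h1, h2⟩
    refine ⟨h1, (Finset.sum_le_sum fun i _ => h2 i).trans ?_⟩
    simp
    rw [mul_div_assoc', div_le_iff₀ (by positivity)]
    nlinarith
  refine lt_of_lt_of_le ?_ (measure_mono hsub)
  rw [Real.volume_Icc_pi]
  simp only [Pi.zero_apply, sub_zero, Finset.prod_const]
  exact ENNReal.pow_pos (ENNReal.ofReal_pos.2 (by positivity)) _

theorem moment_ell {p : ℕ} (T : ℝ) (c : Fin p → ℤ) :
    ∫ x in simp0 p T, ell c x = (∑ i, (c i : ℝ)) * (T * volume.real (simp0 p T) / (p + 1)) := by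
  unfold ell
  rw [integral_finsetSum _ (fun i _ => intOn T (fun x => (c i : ℝ) * x i) (by fun_prop))]
  simp only [integral_const_mul, moment, Finset.sum_mul]

theorem D_vol {p : ℕ} (a : Fin p → ℤ) (L T : ℝ) (hL : 0 < L) (hT : 0 < T)
    (ha : ∀ i, 0 < L + (a i : ℝ) * T) :
    ∫ x in PolyDelta (bundleN p a) (bundleK p L T), (1:ℝ) =
      volume.real (simp0 p T) * (L + T * (∑ i, (a i : ℝ)) / (p + 1)) := by
  rw [fubini a L T hL hT ha (fun _ => 1) continuous_const]
  simp only [intervalIntegral.integral_const, sub_zero, smul_eq_mul, mul_one]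
  rw [integral_add (intOn T _ continuous_const) (intOn T _ (ell_cont a)), moment_ell]
  simp
  ring

theorem D_vol_pos {p : ℕ} (a : Fin p → ℤ) (L T : ℝ) (hL : 0 < L) (hT : 0 < T)
    (ha : ∀ i, 0 < L + (a i : ℝ) * T) : 0 < L + T * (∑ i, (a i : ℝ)) / (p + 1) := by
  have : 0 ≤ ∑ i, (L + (a i : ℝ) * T) := Finset.sum_nonneg fun i _ => (ha i).le
  rw [Finset.sum_add_distrib, ← Finset.sum_mul] at this
  simp at this
  rw [show L + T * (∑ i, (a i : ℝ)) / (p + 1) = (L + (p * L + (∑ i, (a i : ℝ)) * T)) / (p + 1) by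
    field_simp; ring]
  positivity

theorem dot_cm {n : ℕ} (K : Set (Fin n → ℝ)) (hK : IsCompact K) (b : Fin n → ℝ) :
    dot (Cm K) b = (∫ x in K, (1:ℝ))⁻¹ * ∫ x in K, dot x b := by
  have h : ∀ i, Integrable (fun x : Fin n → ℝ => x i) (volume.restrict K) := fun i =>
    (continuous_apply i).continuousOn.integrableOn_compact hK
  unfold dot Cm
  rw [integral_finsetSum _ (fun i _ => (h i).mul_const _), Finset.mul_sum]
  apply Finset.sum_congr rfl
  intro i _
  rw [Pi.smul_apply, eval_integral h, integral_mul_const, smul_eq_mul, mul_assoc]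

theorem main_formula {p : ℕ} (a : Fin p → ℤ) (b : Fin (p+1) → ℤ) (T : ℝ) (hT : 0 < T) :
    ∃ K : ℝ, ∀ L : ℝ, 0 < L → (∀ i, 0 < L + (a i : ℝ) * T) →
      dot (Cm (PolyDelta (bundleN p a) (bundleK p L T))) (fun i => (b i : ℝ)) *
        (L + T * (∑ i, (a i : ℝ)) / (p + 1)) =
      L * (T * (∑ i : Fin p, (b i.castSucc : ℝ)) / (p+1)) +
        (b (Fin.last p) : ℝ) / 2 * (L ^ 2 + 2 * L * (T * (∑ i, (a i : ℝ)) / (p + 1))) + K := by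
  have hV := vol_pos (p := p) T hT
  set V := volume.real (simp0 p T) with hVdef
  set c : Fin p → ℤ := fun i => b i.castSucc with hc
  set β : ℝ := (b (Fin.last p) : ℝ) with hβ
  refine ⟨(∫ x in simp0 p T, (ell c x * ell a x + β / 2 * ell a x ^ 2)) / V, fun L hL ha => ?_⟩
  have hP := D_vol_pos a L T hL hT ha
  have hca := ell_cont a
  have hcc := ell_cont c
  rw [dot_cm _ (D_compact a L T), D_vol a L T hL hT ha,
    fubini a L T hL hT ha _ (by unfold dot; fun_prop)]
  have h1 : ∀ x : Fin p → ℝ, ∫ y in (0:ℝ)..(L + ell a x),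
      dot (Fin.snoc (α := fun _ => ℝ) x y) (fun i => (b i : ℝ)) =
      (L * ell c x + β / 2 * (L ^ 2 + 2 * L * ell a x)) + (ell c x * ell a x + β / 2 * ell a x ^ 2) := by
    intro x
    have : ∀ y : ℝ, dot (Fin.snoc (α := fun _ => ℝ) x y) (fun i => (b i : ℝ)) = ell c x + y * β := by
      intro y
      unfold dot
      rw [Fin.sum_univ_castSucc]
      simp only [Fin.snoc_castSucc, Fin.snoc_last, ell, hc, hβ, mul_comm]
    simp only [this]
    rw [intervalIntegral.integral_add (by simp) (Continuous.intervalIntegrable (by fun_prop) _ _),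
      intervalIntegral.integral_mul_const, integral_id]
    simp
    ring
  simp only [h1]
  rw [integral_add (intOn T _ (by fun_prop)) (intOn T _ (by fun_prop))]
  have h2 : ∫ x in simp0 p T, (L * ell c x + β / 2 * (L ^ 2 + 2 * L * ell a x)) =
      V * (L * (T * (∑ i : Fin p, (b i.castSucc : ℝ)) / (p+1)) +
        β / 2 * (L ^ 2 + 2 * L * (T * (∑ i, (a i : ℝ)) / (p + 1)))) := by
    rw [integral_add (intOn T _ (by fun_prop)) (intOn T _ (by fun_prop)), integral_const_mul,
      integral_const_mul, integral_add (intOn T _ (by fun_prop)) (intOn T _ (by fun_prop)),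
      integral_const_mul, moment_ell, moment_ell]
    simp [← hVdef, hc]
    ring
  rw [h2, ← hVdef]
  clear_value V
  generalize (∫ x in simp0 p T, (ell c x * ell a x + β / 2 * ell a x ^ 2)) = Z
  generalize L + T * (∑ i, (a i : ℝ)) / (p + 1) = P at hP ⊢
  field_simp

theorem cm_shift {p : ℕ} (a : Fin p → ℤ) (L T : ℝ) (hL : 0 < L) (hT : 0 < T)
    (ha : ∀ i, 0 < L + (a i : ℝ) * T) (v b : Fin (p+1) → ℝ) :
    dot (Cm (PolyDelta (bundleN p a) (fun j => bundleK p L T j + dot v (bundleN p a j)))) b =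
    dot (Cm (PolyDelta (bundleN p a) (bundleK p L T))) b + dot v b := by
  set D := PolyDelta (bundleN p a) (bundleK p L T) with hD
  set D' := PolyDelta (bundleN p a) (fun j => bundleK p L T j + dot v (bundleN p a j)) with hD'
  have hDc : IsCompact D := D_compact a L T
  have hpre : (fun x => x + v) ⁻¹' D' = D := by
    ext x; exact mem_shift _ _ v x
  have himg : D' = (fun x => x + v) '' D := by
    rw [← hpre, Set.image_preimage_eq _ (add_right_surjective v)]
  have hDc' : IsCompact D' := by
    rw [himg]; exact hDc.image (by fun_prop)
  have hvol : 0 < ∫ x in D, (1:ℝ) := by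
    rw [D_vol a L T hL hT ha]
    exact mul_pos (vol_pos T hT) (D_vol_pos a L T hL hT ha)
  have hmp := fun g : (Fin (p+1) → ℝ) → ℝ =>
    (measurePreserving_add_right volume v).setIntegral_preimage_emb (measurableEmbedding_addRight v) g D'
  simp only [hpre] at hmp
  rw [dot_cm _ hDc, dot_cm _ hDc', ← hmp, ← hmp]
  simp only [dot_add]
  rw [integral_add]
  · have : ∫ x in D, dot v b = (∫ x in D, (1:ℝ)) * dot v b := by
      rw [← integral_mul_const]; simp
    rw [this]
    field_simp
  · exact Continuous.continuousOn (by unfold dot; fun_prop) |>.integrableOn_compact hDc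
  · exact continuousOn_const.integrableOn_compact hDc

theorem stmt16 (p : ℕ) (hp : 1 < p) (a : Fin p → ℤ) (L T : ℝ)
    (hL : 0 < L) (hT : 0 < T) (ha : ∀ i, 0 < L + (a i : ℝ) * T)
    (b : Fin (p + 1) → ℤ) (R : Fin (p + 3) → ℝ) (C : ℝ)
    (hml : ∀ k ∈ chamber (bundleN p a) (bundleK p L T),
      dot (Cm (PolyDelta (bundleN p a) k)) (fun i => (b i : ℝ)) =
        (∑ j, R j * k j) + C) :
    (∑ j, R j) = 0 := by

  have hl := hml _ (mem_chamber a L T hL hT ha L T hL hT ha)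
  have hs := hml _ (chamber_shift _ _ _ (fun _ => -1) (mem_chamber a L T hL hT ha L T hL hT ha))
  rw [cm_shift a L T hL hT ha, hl] at hs
  simp only [mul_add, Finset.sum_add_distrib] at hs
  have hs' : dot (fun _ => -1) (fun i => (b i : ℝ)) = ∑ j, R j * dot (fun _ => -1) (bundleN p a j) := by
    linarith
  rw [sum_idx (fun j => R j * dot (fun _ => -1) (bundleN p a j))] at hs'
  rw [sum_idx R]
  simp only [dot_lt, dot_p, dot_p1, dot_p2] at hs'
  have hb : dot (fun _ => -1) (fun i => (b i : ℝ)) =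
      - (∑ i : Fin p, (b i.castSucc : ℝ)) - (b (Fin.last p) : ℝ) := by
    unfold dot
    rw [Fin.sum_univ_castSucc]
    simp [sub_eq_add_neg]
  have hell : ell a (fun _ => -1) = - ∑ i, (a i : ℝ) := by simp [ell]
  rw [hb, hell] at hs'
  simp at hs'
  set B := ∑ i : Fin p, (b i.castSucc : ℝ)
  set A := ∑ i, (a i : ℝ) with hA
  set β := (b (Fin.last p) : ℝ)
  set S := ∑ i : Fin p, R ⟨i, by omega⟩
  set r := R ⟨p, by omega⟩ with hr
  set r1 := R ⟨p+1, by omega⟩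
  set r2 := R ⟨p+2, by omega⟩ with hr2
  have hq : (0:ℝ) < p + 1 := by positivity
  have key : ∀ τ : ℝ, 0 < τ → τ ≤ T →
      r2 = β / 2 ∧ τ * B / (p+1) + β * (τ * A / (p+1)) = (r * τ + C) + τ * A / (p+1) * r2 := by
    intro τ hτ hτT
    obtain ⟨K, hK⟩ := main_formula a b τ hτ
    have hgood : ∀ l, L ≤ l → ∀ i, 0 < l + (a i : ℝ) * τ := by
      intro l hl i
      have h1 := ha i
      have h2 : 0 < T * (l + (a i : ℝ) * τ) := by
        have : T * (l + (a i : ℝ) * τ) = T * (l - L) + L * (T - τ) + τ * (L + a i * T) := by ring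
        rw [this]
        have := mul_pos hτ h1
        have := mul_nonneg hT.le (sub_nonneg.2 hl)
        have := mul_nonneg hL.le (sub_nonneg.2 hτT)
        linarith
      exact (mul_pos_iff_of_pos_left hT).1 h2
    have hall : ∀ l, L ≤ l → (r * τ + r2 * l + C) * (l + τ * A / (p+1)) =
        l * (τ * B / (p+1)) + β / 2 * (l ^ 2 + 2 * l * (τ * A / (p + 1))) + K := by
      intro l hl
      have hl0 : 0 < l := by linarith
      rw [← hK l hl0 (hgood l hl), hml _ (mem_chamber a L T hL hT ha l τ hl0 hτ (hgood l hl))]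
      rw [sum_idx (fun j => R j * bundleK p l τ j)]
      simp only [bK_lt, bK_p, bK_p1, bK_p2]
      simp [← hr, ← hr2, ← hA]
    generalize τ * A / (p+1) = u at hall ⊢
    generalize τ * B / (p+1) = w at hall ⊢
    have e0 := hall L le_rfl
    have e1 := hall (L+1) (by linarith)
    have e2 := hall (L+2) (by linarith)
    have h2 : r2 = β / 2 := by linarith
    refine ⟨h2, ?_⟩
    rw [h2] at e0 e1 ⊢
    linarith
  obtain ⟨k1, k2⟩ := key T hT le_rfl
  obtain ⟨_, k3⟩ := key (T/2) (by linarith) (by linarith)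
  have hC : C = 0 := by
    rw [k1] at k2 k3
    field_simp at k2 k3
    have : C * (p+1) = 0 := by linarith
    rcases mul_eq_zero.1 this with h | h
    · exact h
    · exact absurd h hq.ne'
  rw [k1, hC] at k2
  have k4 : B + β * A / 2 = r * (p+1) := by
    have : T * (B + β * A / 2) = T * (r * (p+1)) := by
      field_simp at k2
      linarith
    exact mul_left_cancel₀ hT.ne' this
  rw [k1] at hs' ⊢
  first
  | linarith
  | nlinarith
end
end

section
/- Let n ≥ 1 be an integer and τ, λ real numbers with 0 < λ < τ, set σ = τ − λ, and let Δ = {x ∈ ℝ^n : ∑_{i=1}^n x_i ≤ τ, 0 ≤ x_i for all i, and x_n ≤ λ} (the truncated simplex). Then Cm(Δ) = (1/(τ^n − σ^n)) · ( ((τ^{n+1} − σ^{n+1})/(n+1)) · (1,…,1) − λ σ^n e_n ), where e_n is the n-th standard basis vector. -/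
open MeasureTheory

noncomputable section

/-- The truncated simplex `{x ∈ ℝ^n : ∑ x_i ≤ τ, 0 ≤ x_i, x_n ≤ λ}`. -/
def truncSimplex (n : ℕ) (hn : 1 ≤ n) (T L : ℝ) : Set (Fin n → ℝ) :=
  {x | (∑ i, x i) ≤ T ∧ (∀ i, 0 ≤ x i) ∧ x ⟨n - 1, by omega⟩ ≤ L}

def simpS (m : ℕ) (T : ℝ) : Set (Fin m → ℝ) := {x | (∑ i, x i) ≤ T ∧ ∀ i, 0 ≤ x i}

def simpD (m : ℕ) (T L : ℝ) : Set (Fin (m + 1) → ℝ) :=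
  {x | (∑ i, x i) ≤ T ∧ (∀ i, 0 ≤ x i) ∧ x (Fin.last m) ≤ L}

lemma simpS_succ (m : ℕ) (T : ℝ) : simpS (m + 1) T = simpD m T T := by
  ext x
  simp only [simpS, simpD, Set.mem_setOf_eq]
  refine ⟨fun h => ⟨h.1, h.2, ?_⟩, fun h => ⟨h.1, h.2.1⟩⟩
  exact (Finset.single_le_sum (fun i _ => h.2 i) (Finset.mem_univ (Fin.last m))).trans h.1

lemma isClosed_simpD (m : ℕ) (T L : ℝ) : IsClosed (simpD m T L) := by
  have : simpD m T L = {x | (∑ i, x i) ≤ T} ∩ ((⋂ i, {x | 0 ≤ x i}) ∩ {x | x (Fin.last m) ≤ L}) := by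
    ext x; simp [simpD]
  rw [this]
  refine IsClosed.inter (isClosed_le (by fun_prop) (by fun_prop)) (IsClosed.inter
    (isClosed_iInter fun i => isClosed_le (by fun_prop) (by fun_prop))
    (isClosed_le (by fun_prop) (by fun_prop)))

lemma isCompact_simpD (m : ℕ) (T L : ℝ) : IsCompact (simpD m T L) := by
  refine (isCompact_univ_pi (fun _ : Fin (m+1) => isCompact_Icc (a := (0:ℝ)) (b := T))).of_isClosed_subset
    (isClosed_simpD m T L) ?_
  intro x hx i _
  exact ⟨hx.2.1 i, (Finset.single_le_sum (fun i _ => hx.2.1 i) (Finset.mem_univ i)).trans hx.1⟩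

lemma measurableSet_simpS (m : ℕ) (T : ℝ) : MeasurableSet (simpS m T) := by
  have : simpS m T = {x | (∑ i, x i) ≤ T} ∩ (⋂ i, {x | 0 ≤ x i}) := by
    ext x; simp [simpS]
  rw [this]
  exact (IsClosed.inter (isClosed_le (by fun_prop) (by fun_prop))
    (isClosed_iInter fun i => isClosed_le (by fun_prop) (by fun_prop))).measurableSet

lemma simpD_fub (m : ℕ) (T L : ℝ) (hL : 0 ≤ L) (f : (Fin (m + 1) → ℝ) → ℝ)
    (hf : Continuous f) :
    ∫ x in simpD m T L, f x =
      ∫ t in (0:ℝ)..L, ∫ y in simpS m (T - t), f ((Fin.last m).insertNth t y) := by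
  have hm := (isClosed_simpD m T L).measurableSet
  have hi : Integrable ((simpD m T L).indicator f) :=
    (integrable_indicator_iff hm).2 (hf.continuousOn.integrableOn_compact (isCompact_simpD m T L))
  have mp := (volume_preserving_piFinSuccAbove (fun _ : Fin (m+1) => ℝ) (Fin.last m)).symm
  rw [← integral_indicator hm, ← mp.integral_comp' ]
  have hi2 := mp.integrable_comp_of_integrable hi
  rw [Measure.volume_eq_prod] at hi2 ⊢
  have := integral_prod _ hi2
  simp only [Function.comp_def] at this
  rw [this, intervalIntegral.integral_of_le hL, ← integral_Icc_eq_integral_Ioc,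
    ← integral_indicator measurableSet_Icc]
  congr 1
  ext t
  by_cases ht : t ∈ Set.Icc 0 L
  · rw [Set.indicator_of_mem ht, ← integral_indicator (measurableSet_simpS m _)]
    congr 1
    ext y
    simp only [Set.indicator, simpD, simpS, MeasurableEquiv.piFinSuccAbove_symm_apply, Set.mem_setOf_eq]
    congr 1
    simp [Fin.sum_univ_castSucc, Fin.forall_fin_succ', ht.1, ht.2, le_sub_iff_add_le, Fin.insertNthEquiv]
  · rw [Set.indicator_of_notMem ht]
    refine integral_eq_zero_of_ae (Filter.Eventually.of_forall fun y => ?_)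
    apply Set.indicator_of_notMem
    intro h
    apply ht
    have h1 := h.2.1 (Fin.last m)
    have h2 := h.2.2
    simp [Fin.insertNthEquiv] at h1 h2
    exact ⟨h1, h2⟩

lemma int_pow_sub (m : ℕ) (T L : ℝ) :
    ∫ t in (0:ℝ)..L, (T - t) ^ m = (T ^ (m + 1) - (T - L) ^ (m + 1)) / (m + 1) := by
  rw [intervalIntegral.integral_comp_sub_left (fun x => x ^ m), integral_pow]
  simp

lemma int_mul_pow_sub (m : ℕ) (T L : ℝ) :
    ∫ t in (0:ℝ)..L, t * (T - t) ^ m = T * ((T ^ (m + 1) - (T - L) ^ (m + 1)) / (m + 1))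
      - (T ^ (m + 2) - (T - L) ^ (m + 2)) / (m + 2) := by
  have : ∀ t : ℝ, t * (T - t) ^ m = T * (T - t) ^ m - (T - t) ^ (m + 1) := by intro t; ring
  simp_rw [this]
  rw [intervalIntegral.integral_sub (Continuous.intervalIntegrable (by fun_prop) _ _)
    (Continuous.intervalIntegrable (by fun_prop) _ _), intervalIntegral.integral_const_mul,
    int_pow_sub, int_pow_sub]
  push_cast
  ring

lemma simpD_vol_of (m : ℕ) (T L : ℝ) (hL : 0 ≤ L) (hLT : L ≤ T)
    (h : ∀ T, 0 ≤ T → ∫ _ in simpS m T, (1:ℝ) = T ^ m / m.factorial) :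
    ∫ _ in simpD m T L, (1:ℝ) = (T ^ (m + 1) - (T - L) ^ (m + 1)) / (m + 1).factorial := by
  rw [simpD_fub m T L hL _ continuous_const]
  rw [intervalIntegral.integral_congr (g := fun t => (T - t) ^ m / m.factorial)]
  · rw [intervalIntegral.integral_div, int_pow_sub, Nat.factorial_succ]
    push_cast
    field_simp
  · intro t ht
    rw [Set.uIcc_of_le hL] at ht
    exact h _ (by linarith [ht.2])

lemma simpS_vol (m : ℕ) : ∀ T : ℝ, 0 ≤ T → ∫ _ in simpS m T, (1:ℝ) = T ^ m / m.factorial := by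
  induction m with
  | zero =>
    intro T hT
    have : simpS 0 T = Set.univ := by ext x; simp [simpS, hT]
    rw [this]
    simp [Measure.real, volume_pi]
  | succ m ih =>
    intro T hT
    rw [simpS_succ, simpD_vol_of m T T hT le_rfl ih]
    simp

lemma simpD_last (m : ℕ) (T L : ℝ) (hL : 0 ≤ L) (hLT : L ≤ T) :
    ∫ x in simpD m T L, x (Fin.last m) = (T * ((T ^ (m + 1) - (T - L) ^ (m + 1)) / (m + 1))
      - (T ^ (m + 2) - (T - L) ^ (m + 2)) / (m + 2)) / m.factorial := by
  rw [simpD_fub m T L hL _ (continuous_apply _)]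
  rw [intervalIntegral.integral_congr (g := fun t => t * (T - t) ^ m / m.factorial)]
  · rw [intervalIntegral.integral_div, int_mul_pow_sub]
  · intro t ht
    rw [Set.uIcc_of_le hL] at ht
    have := simpS_vol m (T - t) (by linarith [ht.2])
    simp only [Fin.insertNth_apply_same]
    rw [mul_div_assoc, ← this, ← integral_const_mul, mul_one]

lemma simpD_cast_of (m : ℕ) (T L : ℝ) (hL : 0 ≤ L) (hLT : L ≤ T) (i : Fin m)
    (h : ∀ T, 0 ≤ T → ∫ x in simpS m T, x i = T ^ (m + 1) / (m + 1).factorial) :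
    ∫ x in simpD m T L, x i.castSucc =
      (T ^ (m + 2) - (T - L) ^ (m + 2)) / (m + 2).factorial := by
  rw [simpD_fub m T L hL _ (continuous_apply _)]
  rw [intervalIntegral.integral_congr (g := fun t => (T - t) ^ (m + 1) / (m + 1).factorial)]
  · rw [intervalIntegral.integral_div, int_pow_sub, Nat.factorial_succ (m + 1)]
    push_cast
    field_simp
  · intro t ht
    rw [Set.uIcc_of_le hL] at ht
    simpa using h _ (by linarith [ht.2])

lemma simpS_coord (m : ℕ) : ∀ (i : Fin m) (T : ℝ), 0 ≤ T →
    ∫ x in simpS m T, x i = T ^ (m + 1) / (m + 1).factorial := by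
  induction m with
  | zero => exact fun i => i.elim0
  | succ m ih =>
    intro i T hT
    rw [simpS_succ]
    refine Fin.lastCases ?_ (fun i => ?_) i
    · rw [simpD_last m T T hT le_rfl, Nat.factorial_succ, Nat.factorial_succ]
      push_cast
      simp only [sub_self, ne_eq, Nat.add_eq_zero_iff, one_ne_zero, OfNat.ofNat_ne_zero, and_false, not_false_eq_true, zero_pow, sub_zero]
      field_simp
      ring
    · rw [simpD_cast_of m T T hT le_rfl i (ih i)]
      simp

theorem stmt17 (n : ℕ) (hn : 1 ≤ n) (T L : ℝ) (hL : 0 < L) (hLT : L < T)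
    (σ : ℝ) (hσ : σ = T - L) :
    Cm (truncSimplex n hn T L) =
      (T ^ n - σ ^ n)⁻¹ •
        (((T ^ (n + 1) - σ ^ (n + 1)) / ((n : ℝ) + 1)) • ((fun _ => 1) : Fin n → ℝ) -
          (L * σ ^ n) • (Pi.single (⟨n - 1, by omega⟩ : Fin n) 1 : Fin n → ℝ)) := by
  obtain ⟨m, rfl⟩ : ∃ m, n = m + 1 := ⟨n - 1, by omega⟩
  have hD : truncSimplex (m + 1) hn T L = simpD m T L := rfl
  have hlast : (⟨m + 1 - 1, by omega⟩ : Fin (m + 1)) = Fin.last m := rfl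
  rw [hD, hlast, Cm, simpD_vol_of m T L hL.le hLT.le (simpS_vol m)]
  subst hσ
  have hne : T ^ (m + 1) - (T - L) ^ (m + 1) ≠ 0 := by
    have := pow_lt_pow_left₀ (show T - L < T by linarith) (by linarith) (Nat.succ_ne_zero m)
    exact (sub_pos.2 this).ne'
  have hint : ∀ i, Integrable (fun x : Fin (m + 1) → ℝ => x i) (volume.restrict (simpD m T L)) :=
    fun i => (continuous_apply i).continuousOn.integrableOn_compact (isCompact_simpD m T L)
  ext i
  rw [Pi.smul_apply, eval_integral hint]
  have hf : (m.factorial : ℝ) ≠ 0 := by positivity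
  refine Fin.lastCases ?_ (fun i => ?_) i
  · rw [simpD_last m T L hL.le hLT.le, Nat.factorial_succ]
    simp only [Pi.smul_apply, Pi.sub_apply, Pi.single_eq_same, smul_eq_mul, mul_one]
    push_cast
    rw [inv_div, div_eq_inv_mul, mul_assoc]
    congr 1
    field_simp
    ring
  · rw [simpD_cast_of m T L hL.le hLT.le i (simpS_coord m i), Nat.factorial_succ (m + 1)]
    have hs : (Pi.single (Fin.last m) 1 : Fin (m + 1) → ℝ) i.castSucc = 0 :=
      Pi.single_eq_of_ne (Fin.castSucc_lt_last i).ne _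
    simp only [Pi.smul_apply, Pi.sub_apply, hs, smul_eq_mul, mul_one, mul_zero, sub_zero]
    rw [inv_div, div_eq_inv_mul, mul_assoc]
    congr 1
    have hf : ((m + 1).factorial : ℝ) ≠ 0 := by positivity
    push_cast
    field_simp
end
end

section
/- Let n ≥ 2 be an integer and τ, λ real numbers with 0 < λ < τ. In ℝ^n with standard basis e_1,…,e_n, let n_j = −e_j for j = 1,…,n, n_{n+1} = ∑_{i=1}^n e_i, n_{n+2} = e_n, and let Δ = Δ(k⁰) with k⁰ = (0,…,0, τ, λ) (so Δ is the simplex S_n(τ) truncated by the hyperplane x_n = λ; its toric manifold is the one-point blow up of ℂP^n). For b = (b_1,…,b_n) ∈ ℤ^n, the pair (Δ, b) is mass linear if and only if n · b_n = ∑_{j=1}^{n−1} b_j. -/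
open MeasureTheory

noncomputable section

/-- Conormals of the truncated simplex: `n_j = -e_j` for `j < n`, `n_{n+1} = ∑ e_i`,
`n_{n+2} = e_n`. -/
def truncN (n : ℕ) : Fin (n + 2) → Fin n → ℝ := fun j i =>
  if (j : ℕ) < n then (if (i : ℕ) = (j : ℕ) then -1 else 0)
  else if (j : ℕ) = n then 1
  else if (i : ℕ) = n - 1 then 1
  else 0

/-- Support numbers `k⁰ = (0,…,0,τ,λ)` of the truncated simplex. -/
def truncK (n : ℕ) (T L : ℝ) : Fin (n + 2) → ℝ := fun j =>
  if (j : ℕ) = n then T else if (j : ℕ) = n + 1 then L else 0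

def Sx (m : ℕ) (s : ℝ) : Set (Fin m → ℝ) := {x | (∀ j, 0 ≤ x j) ∧ ∑ j, x j ≤ s}

def Kx (m : ℕ) (i : Fin (m+1)) (T L : ℝ) : Set (Fin (m+1) → ℝ) :=
  {x | (∀ j, 0 ≤ x j) ∧ ∑ j, x j ≤ T ∧ x i ≤ L}

lemma Sx_compact (m : ℕ) (s : ℝ) : IsCompact (Sx m s) := by
  have hc : IsClosed (Sx m s) := by
    have : Sx m s = (⋂ j, {x | 0 ≤ x j}) ∩ {x | ∑ j, x j ≤ s} := by
      ext x; simp [Sx]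
    rw [this]
    exact (isClosed_iInter fun j => isClosed_le (by fun_prop) (by fun_prop)).inter
      (isClosed_le (by fun_prop) (by fun_prop))
  refine (isCompact_Icc (a := (fun _ => 0 : Fin m → ℝ)) (b := fun _ => s)).of_isClosed_subset hc ?_
  rintro x ⟨h0, h1⟩
  refine ⟨h0, fun j => ?_⟩
  exact (Finset.single_le_sum (f := x) (fun i _ => h0 i) (Finset.mem_univ j)).trans h1

lemma Kx_compact (m : ℕ) (i : Fin (m+1)) (T L : ℝ) : IsCompact (Kx m i T L) := by
  have : Kx m i T L = Sx (m+1) T ∩ {x | x i ≤ L} := by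
    ext x; simp [Kx, Sx, and_assoc]
  rw [this]
  exact (Sx_compact _ _).inter_right (isClosed_le (by fun_prop) (by fun_prop))

lemma Sx_eq_Kx (m : ℕ) (i : Fin (m+1)) (s : ℝ) : Sx (m+1) s = Kx m i s s := by
  ext x
  simp only [Kx, Sx, Set.mem_ofPred_eq]
  constructor
  · rintro ⟨h0, h1⟩
    exact ⟨h0, h1, (Finset.single_le_sum (f := x) (fun i _ => h0 i) (Finset.mem_univ i)).trans h1⟩
  · rintro ⟨h0, h1, _⟩
    exact ⟨h0, h1⟩

lemma mem_Kx_insert (m : ℕ) (i : Fin (m+1)) (T L t : ℝ) (y : Fin m → ℝ) :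
    i.insertNth t y ∈ Kx m i T L ↔ t ∈ Set.Icc 0 L ∧ y ∈ Sx m (T - t) := by
  simp only [Kx, Sx, Set.mem_ofPred_eq, Fin.forall_iff_succAbove i, Fin.sum_univ_succAbove _ i,
    Fin.insertNth_apply_same, Fin.insertNth_apply_succAbove, Set.mem_Icc]
  constructor
  · rintro ⟨⟨h1, h2⟩, h3, h4⟩
    exact ⟨⟨h1, h4⟩, h2, by linarith⟩
  · rintro ⟨⟨h1, h4⟩, h2, h3⟩
    exact ⟨⟨h1, h2⟩, by linarith, h4⟩

lemma slice (m : ℕ) (i : Fin (m+1)) (T L : ℝ) (hL : 0 ≤ L) (f : (Fin (m+1) → ℝ) → ℝ)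
    (hf : Continuous f) :
    ∫ x in Kx m i T L, f x = ∫ t in (0:ℝ)..L, ∫ y in Sx m (T - t), f (i.insertNth t y) := by
  have hK := Kx_compact m i T L
  have hmK := hK.measurableSet
  have hint : Integrable ((Kx m i T L).indicator f) :=
    (hf.continuousOn.integrableOn_compact hK).integrable_indicator hmK
  have hmp := (volume_preserving_piFinSuccAbove (fun _ : Fin (m+1) => ℝ) i).symm
  rw [← integral_indicator hmK, ← hmp.integral_comp' , ]
  rw [Measure.volume_eq_prod, integral_prod]
  · rw [intervalIntegral.integral_of_le hL, ← integral_Icc_eq_integral_Ioc,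
      ← integral_indicator measurableSet_Icc]
    congr 1
    ext t
    by_cases ht : t ∈ Set.Icc 0 L
    · rw [Set.indicator_of_mem ht, ← integral_indicator (Sx_compact _ _).measurableSet]
      congr 1
      ext y
      have e : (MeasurableEquiv.piFinSuccAbove (fun _ : Fin (m+1) => ℝ) i).symm (t, y)
        = i.insertNth t y := rfl
      rw [e]
      by_cases hy : y ∈ Sx m (T - t)
      · rw [Set.indicator_of_mem hy, Set.indicator_of_mem ((mem_Kx_insert ..).2 ⟨ht, hy⟩)]
      · rw [Set.indicator_of_notMem hy, Set.indicator_of_notMem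
          (fun h => hy ((mem_Kx_insert ..).1 h).2)]
    · rw [Set.indicator_of_notMem ht]
      apply integral_eq_zero_of_ae
      refine Filter.Eventually.of_forall fun y => ?_
      have e : (MeasurableEquiv.piFinSuccAbove (fun _ : Fin (m+1) => ℝ) i).symm (t, y)
        = i.insertNth t y := rfl
      simp only [e, Pi.zero_apply]
      exact Set.indicator_of_notMem (fun h => ht ((mem_Kx_insert ..).1 h).1) _
  · exact (hmp.integrable_comp_emb (MeasurableEquiv.measurableEmbedding _)).2 hint

lemma int_pow (T L : ℝ) (m : ℕ) :
    ∫ t in (0:ℝ)..L, (T - t)^m = (T^(m+1) - (T-L)^(m+1)) / (m+1) := by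
  rw [intervalIntegral.integral_comp_sub_left (fun t => t^m) T]
  simp

lemma Sx_vol (m : ℕ) : ∀ s : ℝ, 0 ≤ s → ∫ _ in Sx m s, (1:ℝ) = s^m / m.factorial := by
  induction m with
  | zero =>
    intro s hs
    have : Sx 0 s = Set.univ := by ext x; simp [Sx, hs]
    simp [this, measureReal_def, volume_pi, Measure.pi_of_empty]
  | succ m ih =>
    intro s hs
    rw [Sx_eq_Kx m 0 s, slice m 0 s s hs (fun _ => 1) continuous_const]
    have : ∫ t in (0:ℝ)..s, ∫ y in Sx m (s - t), (1:ℝ)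
        = ∫ t in (0:ℝ)..s, (s - t)^m / m.factorial := by
      apply intervalIntegral.integral_congr
      intro t ht
      rw [Set.uIcc_of_le hs] at ht
      exact ih _ (by linarith [ht.2])
    rw [this, intervalIntegral.integral_div, int_pow, Nat.factorial_succ]
    have := Nat.factorial_ne_zero m
    push_cast
    field_simp
    simp

/-- Volume of truncated simplex. -/
lemma Kx_vol (m : ℕ) (i : Fin (m+1)) (T L : ℝ) (hL : 0 ≤ L) (hLT : L ≤ T) :
    ∫ _ in Kx m i T L, (1:ℝ) = (T^(m+1) - (T-L)^(m+1)) / (m+1).factorial := by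
  rw [slice m i T L hL (fun _ => 1) continuous_const]
  have : ∫ t in (0:ℝ)..L, ∫ y in Sx m (T - t), (1:ℝ)
      = ∫ t in (0:ℝ)..L, (T - t)^m / m.factorial := by
    apply intervalIntegral.integral_congr
    intro t ht
    rw [Set.uIcc_of_le hL] at ht
    exact Sx_vol m _ (by linarith [ht.2])
  rw [this, intervalIntegral.integral_div, int_pow, Nat.factorial_succ]
  have := Nat.factorial_ne_zero m
  push_cast
  field_simp

lemma Kx_mom (m : ℕ) (i : Fin (m+1)) (T L : ℝ) (hL : 0 ≤ L) (hLT : L ≤ T) :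
    ∫ x in Kx m i T L, x i = T * ((T^(m+1) - (T-L)^(m+1)) / (m+1).factorial)
      - (m+1) * ((T^(m+2) - (T-L)^(m+2)) / (m+2).factorial) := by
  rw [slice m i T L hL (fun x => x i) (by fun_prop)]
  have : ∫ t in (0:ℝ)..L, ∫ y in Sx m (T - t), ((i.insertNth t y : Fin (m+1) → ℝ) i)
      = ∫ t in (0:ℝ)..L, (T / m.factorial * (T - t)^m - (T - t)^(m+1) / m.factorial) := by
    apply intervalIntegral.integral_congr
    intro t ht
    rw [Set.uIcc_of_le hL] at ht
    have h := Sx_vol m (T - t) (by linarith [ht.2])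
    have h2 : ∫ y in Sx m (T - t), t = t * ∫ y in Sx m (T - t), (1:ℝ) := by
      rw [← integral_const_mul]; simp
    simp only [Fin.insertNth_apply_same]
    rw [h2, h]
    ring
  rw [this, intervalIntegral.integral_sub, intervalIntegral.integral_div,
    intervalIntegral.integral_const_mul, int_pow, int_pow, Nat.factorial_succ (m+1),
    Nat.factorial_succ]
  · have := Nat.factorial_ne_zero m
    push_cast
    field_simp
  · exact Continuous.intervalIntegrable (by fun_prop) _ _
  · exact Continuous.intervalIntegrable (by fun_prop) _ _

lemma Sx_mom (m : ℕ) (i : Fin m) (s : ℝ) (hs : 0 ≤ s) :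
    ∫ x in Sx m s, x i = s^(m+1) / (m+1).factorial := by
  obtain _ | m := m
  · exact i.elim0
  rw [Sx_eq_Kx m i s, Kx_mom m i s s hs le_rfl, Nat.factorial_succ (m+1),
    Nat.factorial_succ]
  have := Nat.factorial_ne_zero m
  push_cast
  field_simp
  simp
  ring

lemma Kx_mom' (m : ℕ) (i : Fin (m+1)) (j : Fin m) (T L : ℝ) (hL : 0 ≤ L) (hLT : L ≤ T) :
    ∫ x in Kx m i T L, x (i.succAbove j) = (T^(m+2) - (T-L)^(m+2)) / (m+2).factorial := by
  rw [slice m i T L hL (fun x => x (i.succAbove j)) (by fun_prop)]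
  have : ∫ t in (0:ℝ)..L, ∫ y in Sx m (T - t), ((i.insertNth t y : Fin (m+1) → ℝ) (i.succAbove j))
      = ∫ t in (0:ℝ)..L, (T - t)^(m+1) / (m+1).factorial := by
    apply intervalIntegral.integral_congr
    intro t ht
    rw [Set.uIcc_of_le hL] at ht
    simp only [Fin.insertNth_apply_succAbove]
    exact Sx_mom m j _ (by linarith [ht.2])
  rw [this, intervalIntegral.integral_div, int_pow, Nat.factorial_succ (m+1)]
  have := Nat.factorial_ne_zero (m+1)
  push_cast
  field_simp

lemma integral_coord {n : ℕ} (K : Set (Fin n → ℝ)) (hK : IsCompact K) (i : Fin n) :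
    (∫ x in K, x) i = ∫ x in K, x i := by
  have hint : IntegrableOn (fun x : Fin n → ℝ => x) K :=
    continuous_id.continuousOn.integrableOn_compact hK
  exact ((ContinuousLinearMap.proj (R := ℝ) (φ := fun _ : Fin n => ℝ) i).integral_comp_comm
    hint).symm

lemma dot_Cm (m : ℕ) (T L : ℝ) (hL : 0 < L) (hLT : L < T) (b : Fin (m+1) → ℝ) :
    dot (Cm (Kx m (Fin.last m) T L)) b = b (Fin.last m) * T +
      ((∑ j : Fin m, b j.castSucc) - (m+1) * b (Fin.last m)) *
      ((T^(m+2) - (T-L)^(m+2)) / (T^(m+1) - (T-L)^(m+1)) / (m+2)) := by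
  have hpos : 0 < T^(m+1) - (T-L)^(m+1) := by
    have := pow_lt_pow_left₀ (by linarith : T - L < T) (by linarith) (Nat.succ_ne_zero m)
    exact sub_pos.2 this
  have h1 : ∀ i, Cm (Kx m (Fin.last m) T L) i =
      ((T^(m+1) - (T-L)^(m+1)) / (m+1).factorial)⁻¹ * ∫ x in Kx m (Fin.last m) T L, x i := by
    intro i
    rw [Cm, Kx_vol m _ T L hL.le hLT.le, Pi.smul_apply, integral_coord _ (Kx_compact ..),
      smul_eq_mul]
  unfold dot
  rw [Fin.sum_univ_castSucc]
  simp only [h1]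
  rw [Kx_mom m _ T L hL.le hLT.le]
  have h2 : ∀ j : Fin m, ∫ x in Kx m (Fin.last m) T L, x j.castSucc =
      (T^(m+2) - (T-L)^(m+2)) / (m+2).factorial := by
    intro j
    have := Kx_mom' m (Fin.last m) j T L hL.le hLT.le
    rwa [Fin.succAbove_last] at this
  simp only [h2]
  rw [← Finset.mul_sum, Nat.factorial_succ (m+1)]
  have := Nat.factorial_ne_zero (m+1)
  push_cast
  field_simp
  ring

lemma dot_a (m : ℕ) (x : Fin (m+1) → ℝ) (i : Fin (m+1)) :
    dot x (truncN (m+1) i.castSucc.castSucc) = - x i := by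
  have : ∀ j : Fin (m+1), ((j:ℕ) = i) = (j = i) := fun j => by rw [Fin.ext_iff]
  have hi : (i:ℕ) < m + 1 := i.2
  simp only [dot, truncN, Fin.val_castSucc, if_pos hi, this]
  simp

lemma dot_b (m : ℕ) (x : Fin (m+1) → ℝ) :
    dot x (truncN (m+1) (Fin.last (m+1)).castSucc) = ∑ j, x j := by
  simp [dot, truncN]

lemma dot_c (m : ℕ) (x : Fin (m+1) → ℝ) :
    dot x (truncN (m+1) (Fin.last (m+2))) = x (Fin.last m) := by
  have : ∀ j : Fin (m+1), ((j:ℕ) = m) = (j = Fin.last m) := fun j => by rw [Fin.ext_iff]; simp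
  simp [dot, truncN, this]

lemma mem_poly (m : ℕ) (k : Fin (m+1+2) → ℝ) (x : Fin (m+1) → ℝ) :
    x ∈ PolyDelta (truncN (m+1)) k ↔ (∀ i : Fin (m+1), - x i ≤ k i.castSucc.castSucc) ∧
      ∑ j, x j ≤ k (Fin.last (m+1)).castSucc ∧ x (Fin.last m) ≤ k (Fin.last (m+2)) := by
  simp only [PolyDelta, Set.mem_ofPred_eq]
  rw [Fin.forall_fin_succ', Fin.forall_fin_succ', dot_b, dot_c]
  simp only [dot_a, and_assoc]

lemma tK_a (m : ℕ) (T L : ℝ) (i : Fin (m+1)) :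
    truncK (m+1) T L i.castSucc.castSucc = 0 := by
  have := i.2
  simp only [truncK, Fin.val_castSucc]
  rw [if_neg (by omega), if_neg (by omega)]

lemma tK_b (m : ℕ) (T L : ℝ) : truncK (m+1) T L (Fin.last (m+1)).castSucc = T := by
  simp [truncK]

lemma tK_c (m : ℕ) (T L : ℝ) : truncK (m+1) T L (Fin.last (m+2)) = L := by
  simp [truncK]

lemma poly_tK (m : ℕ) (T L : ℝ) :
    PolyDelta (truncN (m+1)) (truncK (m+1) T L) = Kx m (Fin.last m) T L := by
  ext x
  rw [mem_poly]
  simp [tK_a, tK_b, tK_c, Kx]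

lemma poly_k (m : ℕ) (k : Fin (m+1+2) → ℝ) :
    PolyDelta (truncN (m+1)) k = (fun x => x + fun i => k i.castSucc.castSucc) ⁻¹'
      Kx m (Fin.last m) (k (Fin.last (m+1)).castSucc + ∑ i : Fin (m+1), k i.castSucc.castSucc)
       (k (Fin.last (m+2)) + k (Fin.last m).castSucc.castSucc) := by
  ext x
  rw [mem_poly]
  simp only [Kx, Set.mem_preimage, Set.mem_ofPred_eq, Pi.add_apply, Finset.sum_add_distrib,
    add_le_add_iff_right]
  refine and_congr (forall_congr' fun i => ?_) Iff.rfl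
  constructor <;> intro h <;> linarith

lemma Cm_translate {n : ℕ} (K : Set (Fin n → ℝ)) (hK : IsCompact K) (a : Fin n → ℝ)
    (hv : ∫ _ in K, (1:ℝ) ≠ 0) : Cm ((fun x => x + a) ⁻¹' K) = Cm K - a := by
  have hmp : MeasurePreserving (fun x : Fin n → ℝ => x + a) volume volume :=
    measurePreserving_add_right volume a
  have he : MeasurableEmbedding (fun x : Fin n → ℝ => x + a) := measurableEmbedding_addRight a
  have h1 : ∫ x in (fun x => x + a) ⁻¹' K, (1:ℝ) = ∫ _ in K, (1:ℝ) :=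
    hmp.setIntegral_preimage_emb he (fun _ => (1:ℝ)) K
  have h2 : ∫ x in (fun x => x + a) ⁻¹' K, x = ∫ x in K, (x - a) := by
    rw [← hmp.setIntegral_preimage_emb he (fun x => x - a) K]
    simp
  have hint : IntegrableOn (fun x : Fin n → ℝ => x) K :=
    continuous_id.continuousOn.integrableOn_compact hK
  have hint2 : IntegrableOn (fun _ : Fin n → ℝ => a) K :=
    continuous_const.continuousOn.integrableOn_compact hK
  have h3 : ∫ x in K, a = (∫ _ in K, (1:ℝ)) • a := by simp
  rw [Cm, h1, h2, integral_sub hint hint2, h3, smul_sub, smul_smul, inv_mul_cancel₀ hv, one_smul]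
  rfl

lemma chamber_aux (m : ℕ) (T L T' L' : ℝ) (hL : 0 < L) (hLT : L < T) (hL' : 0 < L')
    (hLT' : L' < T') (J : Finset (Fin (m+1+2)))
    (h : (⋂ j ∈ J, PolyFacet (truncN (m+1)) (truncK (m+1) T L) j).Nonempty) :
    (⋂ j ∈ J, PolyFacet (truncN (m+1)) (truncK (m+1) T' L') j).Nonempty := by
  rcases J.eq_empty_or_nonempty with rfl | ⟨j0, hj0⟩
  · simp
  obtain ⟨x, hx⟩ := h
  simp only [Set.mem_iInter] at hx
  have hx0 := (hx j0 hj0).1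
  rw [poly_tK] at hx0
  obtain ⟨p0, p1, p2⟩ := hx0
  set h := x (Fin.last m) with hh
  have hTh : 0 < T - h := by linarith
  have h0 : 0 ≤ h := p0 _
  set h' := h * (L'/L) with hh'
  have hh0 : 0 ≤ h' := by positivity
  have hhL : h' ≤ L' := by
    rw [hh', mul_div_assoc', div_le_iff₀ hL]; nlinarith
  set c := (T' - h') / (T - h) with hc
  have hTh' : 0 < T' - h' := by linarith
  have hcpos : 0 < c := div_pos hTh' hTh
  have hcT : c * (T - h) = T' - h' := div_mul_cancel₀ _ hTh.ne'
  rw [Fin.sum_univ_castSucc, ← hh] at p1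
  let y : Fin (m+1) → ℝ := Fin.snoc (α := fun _ => ℝ) (fun j : Fin m => c * x j.castSucc) h'
  have yl : y (Fin.last m) = h' := by simp [y]
  have yc : ∀ j : Fin m, y j.castSucc = c * x j.castSucc := fun j => by simp [y]
  have ys : ∑ j, y j = c * (∑ j : Fin m, x j.castSucc) + h' := by
    rw [Fin.sum_univ_castSucc, yl, Finset.mul_sum]; simp only [yc]
  have hy : y ∈ PolyDelta (truncN (m+1)) (truncK (m+1) T' L') := by
    rw [poly_tK]
    refine ⟨?_, ?_, ?_⟩
    · intro j
      refine Fin.lastCases ?_ (fun j => ?_) j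
      · rw [yl]; exact hh0
      · rw [yc]; exact mul_nonneg hcpos.le (p0 _)
    · rw [ys]
      have := mul_le_mul_of_nonneg_left (show (∑ j : Fin m, x j.castSucc) ≤ T - h by linarith) hcpos.le
      linarith
    · rw [yl]; exact hhL
  refine ⟨y, ?_⟩
  simp only [Set.mem_iInter]
  intro j hj
  refine ⟨hy, ?_⟩
  have hxj := (hx j hj).2
  clear hj
  revert hxj
  refine Fin.lastCases ?_ (fun j => ?_) j
  · rw [dot_c, dot_c, tK_c, tK_c, yl, ← hh]
    intro e
    rw [hh', e]; field_simp
  · refine Fin.lastCases ?_ (fun j => ?_) j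
    · rw [dot_b, dot_b, tK_b, tK_b, ys, Fin.sum_univ_castSucc, ← hh]
      intro e
      rw [show (∑ j : Fin m, x j.castSucc) = T - h by linarith, hcT]; ring
    · rw [dot_a, dot_a, tK_a, tK_a]
      refine Fin.lastCases ?_ (fun j => ?_) j
      · rw [yl, ← hh, hh']; intro e
        rw [show h = 0 by linarith]; simp
      · rw [yc]; intro e
        rw [show x j.castSucc = 0 by linarith]; simp

lemma mem_chamber_s18 (m : ℕ) (T L T' L' : ℝ) (hL : 0 < L) (hLT : L < T) (hL' : 0 < L')
    (hLT' : L' < T') : truncK (m+1) T' L' ∈ chamber (truncN (m+1)) (truncK (m+1) T L) :=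
  fun J => ⟨chamber_aux m T' L' T L hL' hLT' hL hLT J, chamber_aux m T L T' L' hL hLT hL' hLT' J⟩

lemma chamber_sub (m : ℕ) (T L : ℝ) (hL : 0 < L) (hLT : L < T) (k : Fin (m+1+2) → ℝ)
    (hk : k ∈ chamber (truncN (m+1)) (truncK (m+1) T L)) :
    0 < k (Fin.last (m+2)) + k (Fin.last m).castSucc.castSucc ∧
    k (Fin.last (m+2)) + k (Fin.last m).castSucc.castSucc <
      k (Fin.last (m+1)).castSucc + ∑ i : Fin (m+1), k i.castSucc.castSucc := by
  set N := truncN (m+1)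
  set k0 := truncK (m+1) T L with hk0
  let J : Finset (Fin (m+1+2)) :=
    insert (Fin.last (m+2)) (Finset.univ.image fun i : Fin m => i.castSucc.castSucc.castSucc)
  let x0 : Fin (m+1) → ℝ := Fin.snoc (α := fun _ => ℝ) (fun _ : Fin m => 0) L
  have x0l : x0 (Fin.last m) = L := by simp [x0]
  have x0c : ∀ j : Fin m, x0 j.castSucc = 0 := fun j => by simp [x0]
  have hx0 : x0 ∈ PolyDelta N k0 := by
    rw [poly_tK]
    refine ⟨?_, ?_, ?_⟩
    · intro j
      refine Fin.lastCases ?_ (fun j => ?_) j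
      · rw [x0l]; exact hL.le
      · rw [x0c]
    · rw [Fin.sum_univ_castSucc, x0l]; simp only [x0c]; simp; exact hLT.le
    · rw [x0l]
  have hJ0 : (⋂ j ∈ J, PolyFacet N k0 j).Nonempty := by
    refine ⟨x0, ?_⟩
    simp only [Set.mem_iInter]
    intro j hj
    refine ⟨hx0, ?_⟩
    simp only [J, Finset.mem_insert, Finset.mem_image, Finset.mem_univ, true_and] at hj
    rcases hj with rfl | ⟨i, rfl⟩
    · rw [dot_c, hk0, tK_c, x0l]
    · rw [dot_a, hk0, tK_a, x0c, neg_zero]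
  obtain ⟨x, hx⟩ := (hk J).2 hJ0
  have hxm := hx
  simp only [Set.mem_iInter] at hx
  have hxl := hx (Fin.last (m+2)) (by simp [J])
  have hxP := hxl.1
  have hxl := hxl.2
  rw [dot_c] at hxl
  have hxc : ∀ i : Fin m, x i.castSucc = - k i.castSucc.castSucc.castSucc := by
    intro i
    have := (hx i.castSucc.castSucc.castSucc (by simp [J])).2
    rw [dot_a] at this
    linarith
  have hP := (mem_poly _ _ _).1 hxP
  obtain ⟨q0, q1, q2⟩ := hP
  have r0 := q0 (Fin.last m)
  -- any extra active facet would also be active for k0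
  have key : ∀ j, dot x (N j) = k j → (∃ z ∈ PolyDelta N k0, dot z (N j) = k0 j ∧
      (∀ i : Fin m, z i.castSucc = 0) ∧ z (Fin.last m) = L) := by
    intro j hj
    have : (⋂ j' ∈ insert j J, PolyFacet N k j').Nonempty := by
      refine ⟨x, ?_⟩
      simp only [Set.mem_iInter]
      intro j' hj'
      rcases Finset.mem_insert.1 hj' with rfl | h
      · exact ⟨hxP, hj⟩
      · exact hx j' h
    obtain ⟨z, hz⟩ := (hk _).1 this
    simp only [Set.mem_iInter] at hz
    have hzj := hz j (by simp)
    refine ⟨z, hzj.1, hzj.2, fun i => ?_, ?_⟩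
    · have := (hz i.castSucc.castSucc.castSucc (by simp [J])).2
      rw [dot_a, hk0, tK_a] at this
      linarith
    · have := (hz (Fin.last (m+2)) (by simp [J])).2
      rwa [dot_c, hk0, tK_c] at this
  rw [Fin.sum_univ_castSucc] at q1 ⊢
  have hs : ∑ i : Fin m, x i.castSucc = - ∑ i : Fin m, k i.castSucc.castSucc.castSucc := by
    rw [← Finset.sum_neg_distrib]; exact Finset.sum_congr rfl fun i _ => hxc i
  constructor
  · refine lt_of_le_of_ne (by linarith) fun e => ?_
    obtain ⟨z, -, hz, -, hzl⟩ := key (Fin.last m).castSucc.castSucc (by rw [dot_a]; linarith)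
    rw [dot_a, hk0, tK_a] at hz
    linarith
  · refine lt_of_le_of_ne (by linarith) fun e => ?_
    obtain ⟨z, -, hz, hzc, hzl⟩ := key (Fin.last (m+1)).castSucc
      (by rw [dot_b, Fin.sum_univ_castSucc]; linarith)
    rw [dot_b, hk0, tK_b, Fin.sum_univ_castSucc, hzl] at hz
    simp only [hzc] at hz
    simp at hz
    linarith

lemma dot_sub' {n : ℕ} (x y b : Fin n → ℝ) : dot (x - y) b = dot x b - dot y b := by
  simp [dot, sub_mul]

lemma no_affine (m : ℕ) (hm : 1 ≤ m) (A B : ℝ)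
    (h : ∀ u : ℝ, 0 < u → u < 1 → 1 - u^(m+2) = (A + B * u) * (1 - u^(m+1))) : False := by
  open Polynomial in
  have hp : (1 - X^(m+2) : ℝ[X]) = (C A + C B * X) * (1 - X^(m+1)) := by
    apply Polynomial.eq_of_infinite_eval_eq
    refine (Set.Ioo_infinite (show (0:ℝ) < 1 by norm_num)).mono ?_
    rintro u ⟨h0, h1⟩
    simp [h u h0 h1]
  have e0 := congrArg (Polynomial.eval 0) hp
  have e2 := congrArg (fun p => Polynomial.coeff p 1) hp
  have e3 := congrArg (Polynomial.eval 2) hp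
  have e4 := congrArg (Polynomial.eval (-1)) hp
  simp at e0
  subst e0
  have hB : B = 0 := by
    have : (Polynomial.C 1 + Polynomial.C B * Polynomial.X) * (1 - Polynomial.X^(m+1))
      = Polynomial.C 1 + Polynomial.C B * Polynomial.X - Polynomial.X^(m+1)
        - Polynomial.C B * Polynomial.X^(m+2) := by simp; ring
    simp only [this] at e2
    simp [Polynomial.coeff_one, Polynomial.coeff_X_pow, Polynomial.coeff_C_mul] at e2
    rw [if_neg (by omega)] at e2
    linarith
  subst hB
  simp [pow_succ] at e3

lemma main_aux (m : ℕ) (hm : 1 ≤ m) (T L : ℝ) (hL : 0 < L) (hLT : L < T)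
    (b : Fin (m+1) → ℝ) :
    IsMassLinear (truncN (m+1)) (truncK (m+1) T L) b ↔
      ((m:ℝ)+1) * b (Fin.last m) = ∑ j : Fin m, b j.castSucc := by
  constructor
  · rintro ⟨R, C, h⟩
    by_contra hne
    set D := (∑ j : Fin m, b j.castSucc) - (m+1) * b (Fin.last m) with hD
    have hD0 : D ≠ 0 := fun e => hne (by linarith)
    have h' : ∀ u : ℝ, 0 < u → u < 1 → b (Fin.last m) +
        D * ((1 - u^(m+2)) / (1 - u^(m+1)) / (m+2)) =
        R (Fin.last (m+1)).castSucc + R (Fin.last (m+2)) * (1-u) + C := by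
      intro u h0 h1
      have e := h _ (mem_chamber_s18 m T L 1 (1-u) hL hLT (by linarith) (by linarith))
      rw [poly_tK, dot_Cm m _ _ (by linarith) (by linarith), Fin.sum_univ_castSucc,
        Fin.sum_univ_castSucc, tK_b, tK_c] at e
      simp only [tK_a] at e
      simp only [one_pow, mul_one, sub_sub_cancel, mul_zero, Finset.sum_const_zero, zero_add] at e
      exact e
    refine no_affine m hm
      ((R (Fin.last (m+1)).castSucc + R (Fin.last (m+2)) + C - b (Fin.last m)) * (m+2) / D)
      (- R (Fin.last (m+2)) * (m+2) / D) fun u h0 h1 => ?_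
    have e := h' u h0 h1
    have hp : 1 - u^(m+1) ≠ 0 := by
      have := pow_lt_one₀ h0.le h1 (Nat.succ_ne_zero m)
      simp only [Nat.succ_eq_add_one] at this
      linarith
    have hm2 : (m:ℝ) + 2 ≠ 0 := by positivity
    generalize hP : 1 - u^(m+1) = P at *
    generalize hQ : 1 - u^(m+2) = Q at *
    have e1 : D * (Q / P / (m+2)) = R (Fin.last (m+1)).castSucc + R (Fin.last (m+2)) * (1-u) + C
      - b (Fin.last m) := by linarith
    field_simp at e1 ⊢
    linarith
  · intro hb
    refine ⟨Fin.snoc (α := fun _ => ℝ) (Fin.snoc (α := fun _ => ℝ)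
      (fun i : Fin (m+1) => b (Fin.last m) - b i) (b (Fin.last m))) 0, 0, fun k hk => ?_⟩
    obtain ⟨h1, h2⟩ := chamber_sub m T L hL hLT k hk
    rw [poly_k, Cm_translate _ (Kx_compact ..), dot_sub', dot_Cm m _ _ h1 h2, ← hb,
      Fin.sum_univ_castSucc (n := m+2), Fin.sum_univ_castSucc (n := m+1)]
    · simp only [Fin.snoc_castSucc, Fin.snoc_last, dot, sub_mul, Finset.sum_sub_distrib,
        mul_add, Finset.mul_sum]
      simp only [mul_comm (b _)]
      ring
    · rw [Kx_vol m _ _ _ h1.le h2.le]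
      have := pow_lt_pow_left₀ (sub_lt_self _ h1) (sub_nonneg.2 h2.le) (Nat.succ_ne_zero m)
      exact (div_pos (sub_pos.2 this) (by positivity)).ne'

theorem stmt18 (n : ℕ) (hn : 2 ≤ n) (T L : ℝ) (hL : 0 < L) (hLT : L < T)
    (b : Fin n → ℤ) :
    IsMassLinear (truncN n) (truncK n T L) (fun i => (b i : ℝ)) ↔
      (n : ℤ) * b ⟨n - 1, by omega⟩ =
        ∑ j ∈ Finset.univ.filter (fun j : Fin n => (j : ℕ) < n - 1), b j := by
  obtain ⟨m, rfl⟩ : ∃ m, n = m + 1 := ⟨n - 1, by omega⟩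
  rw [main_aux m (by omega) T L hL hLT]
  have e : ∑ j ∈ Finset.univ.filter (fun j : Fin (m+1) => (j : ℕ) < m + 1 - 1), b j
      = ∑ j : Fin m, b j.castSucc := by
    rw [Finset.sum_filter, Fin.sum_univ_castSucc]
    simp
  rw [e]
  have e2 : (⟨m + 1 - 1, by omega⟩ : Fin (m+1)) = Fin.last m := rfl
  rw [e2]
  constructor
  · intro h
    exact_mod_cast h
  · intro h
    exact_mod_cast h
end
end
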